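/- arXiv:math/0502148 — 2 statements merged into one kernel-verified Lean document; each statement's English description precedes it below -/
import Mathlib

section
/- The topological fundamental group π₁(HE,p) of the Hawaiian earring, endowed with the quotient topology, is not a Baire space. -/
noncomputable section

/-- The loop space `C_q(Z)` : the space of continuous loops at `q`, i.e. continuous maps
`[0,1] → Z` sending `0` and `1` to `q`, topologized as a subspace of `C([0,1], Z)` with
the compact-open topology. -/
abbrev LoopSp (Z : Type*) [TopologicalSpace Z] (q : Z) : Type _ :=
  {f : C(unitInterval, Z) // f 0 = q ∧ f 1 = q}

/-- The topological fundamental group `π₁(Z,q)` : the quotient of the loop space `C_q(Z)`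
obtained by identifying loops lying in the same path component of `C_q(Z)`, endowed with
the quotient topology. -/
abbrev TopPi1 (Z : Type*) [TopologicalSpace Z] (q : Z) : Type _ :=
  Quotient (pathSetoid (LoopSp Z q))

/-- The circle `Cₙ ⊆ ℝ²` of radius `1/n` centered at `(1/n, 0)` (intended for `n ≥ 1`). -/
def circ (n : ℕ) : Set (ℝ × ℝ) :=
  {q | (q.1 - 1 / n) ^ 2 + q.2 ^ 2 = (1 / n) ^ 2}

/-- The Hawaiian earring `HE = ⋃_{n ≥ 1} Cₙ`. -/
def HE : Set (ℝ × ℝ) := ⋃ n, ⋃ (_ : 1 ≤ n), circ n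

lemma origin_mem_HE : ((0 : ℝ), (0 : ℝ)) ∈ HE := by
  refine Set.mem_iUnion.2 ⟨1, Set.mem_iUnion.2 ⟨le_refl 1, ?_⟩⟩
  simp [circ]

/-- The basepoint `p = (0,0)` of the Hawaiian earring. -/
def hep : HE := ⟨((0 : ℝ), (0 : ℝ)), origin_mem_HE⟩

open unitInterval in
lemma he_lift {A : Type*} [TopologicalSpace A] (a b : C(I × A, ℝ))
    (h : ∀ x, a x ≠ 0 ∨ b x ≠ 0) (ρ c : ℝ) (hρ : 0 < ρ)
    (ha : ∀ y, a (0, y) = ρ * Real.cos c) (hb : ∀ y, b (0, y) = ρ * Real.sin c) :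
    ∃ φ : C(I × A, ℝ), (∀ y, φ (0, y) = c) ∧
      ∀ x, ∃ r : ℝ, 0 < r ∧ a x = r * Real.cos (φ x) ∧ b x = r * Real.sin (φ x) := by
  have hne : ∀ x, (⟨a x, b x⟩ : ℂ) ≠ 0 := by
    intro x hx
    rw [Complex.ext_iff] at hx
    rcases h x with h | h
    · exact h hx.1
    · exact h hx.2
  have hcont : Continuous (fun x : I × A => (⟨a x, b x⟩ : ℂ)) := by
    have : (fun x : I × A => (⟨a x, b x⟩ : ℂ)) = fun x => (a x : ℂ) + (b x : ℂ) * Complex.I := by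
      funext x
      apply Complex.ext <;> simp
    rw [this]
    fun_prop
  let H : C(I × A, {z : ℂ // z ≠ 0}) := ⟨fun x => ⟨⟨a x, b x⟩, hne x⟩, by fun_prop⟩
  let z0 : ℂ := ⟨Real.log ρ, c⟩
  have hz : ∀ z : ℂ, Complex.exp z = ⟨Real.exp z.re * Real.cos z.im, Real.exp z.re * Real.sin z.im⟩ := by
    intro z
    apply Complex.ext
    · simp [Complex.exp_re]
    · simp [Complex.exp_im]
  have H0 : ∀ y, H (0, y) = (⟨_, Complex.exp_ne_zero z0⟩ : {z : ℂ // z ≠ 0}) := by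
    intro y
    apply Subtype.ext
    change (⟨a (0, y), b (0, y)⟩ : ℂ) = Complex.exp z0
    rw [hz, ha, hb]
    simp [z0, Real.exp_log hρ]
  let Λ := Complex.isCoveringMap_exp.liftHomotopy H (ContinuousMap.const A z0) H0
  have hΛ : ∀ x, Complex.exp (Λ x) = ⟨a x, b x⟩ := by
    intro x
    have := congr_fun (Complex.isCoveringMap_exp.liftHomotopy_lifts H (ContinuousMap.const A z0) H0) x
    exact congrArg Subtype.val this
  refine ⟨⟨fun x => (Λ x).im, Complex.continuous_im.comp Λ.continuous⟩, ?_, ?_⟩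
  · intro y
    have := Complex.isCoveringMap_exp.liftHomotopy_zero H (ContinuousMap.const A z0) H0 y
    change (Λ (0, y)).im = c
    rw [show Λ (0, y) = z0 from this]
  · intro x
    refine ⟨Real.exp (Λ x).re, Real.exp_pos _, ?_, ?_⟩
    · have := hΛ x
      rw [hz] at this
      exact (congrArg Complex.re this).symm
    · have := hΛ x
      rw [hz] at this
      exact (congrArg Complex.im this).symm

/-- a real function whose sine vanishes identically is constant -/
lemma he_const {X : Type*} [TopologicalSpace X] [PreconnectedSpace X] (g : X → ℝ)
    (hg : Continuous g) (h : ∀ x, Real.sin (g x) = 0) (x y : X) : g x = g y := by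
  wlog hxy : g x < g y generalizing x y
  · rcases lt_trichotomy (g x) (g y) with h1 | h1 | h1
    · exact this x y h1
    · exact h1
    · exact (this y x h1).symm
  exfalso
  set d := min (g y - g x) 1 with hd
  have hd0 : 0 < d := lt_min (by linarith) one_pos
  have hd1 : d ≤ 1 := min_le_right _ _
  have hd2 : d ≤ g y - g x := min_le_left _ _
  obtain ⟨z, hz⟩ := mem_range_of_exists_le_of_exists_ge hg (c := g x + d) ⟨x, by linarith⟩
    ⟨y, by linarith⟩
  have h1 := h z
  rw [hz, Real.sin_add, h x, zero_mul, zero_add] at h1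
  have h2 : Real.sin d > 0 := Real.sin_pos_of_pos_of_lt_pi hd0 (by linarith [Real.pi_gt_three])
  rcases mul_eq_zero.1 h1 with h3 | h3
  · have := Real.sin_sq_add_cos_sq (g x)
    rw [h x, h3] at this
    norm_num at this
  · linarith

/-- a function whose (shifted) sine never vanishes varies by at most π -/
lemma he_var {X : Type*} [TopologicalSpace X] (S : Set X) (hS : IsPreconnected S) (g : X → ℝ)
    (hg : ContinuousOn g S) (c : ℝ) (h : ∀ x ∈ S, Real.sin (g x + c) ≠ 0) (x y : X)
    (hx : x ∈ S) (hy : y ∈ S) : |g x - g y| ≤ Real.pi := by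
  have key : ∀ x ∈ S, ∀ y ∈ S, g x - g y ≤ Real.pi := by
    intro x hx y hy
    by_contra hlt
    push Not at hlt
    -- multiple of π
    set k : ℤ := ⌈(g y + c) / Real.pi⌉ with hk
    have h1 : (g y + c) / Real.pi ≤ k := Int.le_ceil _
    have h2 : (k : ℝ) < (g y + c) / Real.pi + 1 := Int.ceil_lt_add_one _
    have hp := Real.pi_pos
    rw [div_le_iff₀ hp] at h1
    have h2' : (k : ℝ) * Real.pi < (g y + c) + Real.pi := by
      have := mul_lt_mul_of_pos_right h2 hp
      rwa [add_mul, div_mul_cancel₀ _ hp.ne', one_mul] at this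
    have : (k : ℝ) * Real.pi - c ∈ Set.Icc (g y) (g x) := ⟨by linarith, by linarith⟩
    obtain ⟨z, hzS, hz⟩ := hS.intermediate_value hy hx hg this
    apply h z hzS
    rw [hz, sub_add_cancel, Real.sin_int_mul_pi]
  rw [abs_le]
  constructor
  · linarith [key y hy x hx]
  · exact key x hx y hy

/-- bump selecting the integer `n` -/
def heBump (n : ℕ) (q : ℝ × ℝ) : ℝ := max 0 (1 - |2 * q.1 / (q.1 ^ 2 + q.2 ^ 2) - n|)

def heRc (n : ℕ) (q : ℝ × ℝ) : ℝ := 1 - n * (heBump n q * q.1)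
def heRs (n : ℕ) (q : ℝ × ℝ) : ℝ := - (n * (heBump n q * q.2))

lemma heBump_nonneg (n : ℕ) (q : ℝ × ℝ) : 0 ≤ heBump n q := le_max_left _ _
lemma heBump_le (n : ℕ) (q : ℝ × ℝ) : heBump n q ≤ 1 :=
  max_le zero_le_one (by linarith [abs_nonneg (2 * q.1 / (q.1 ^ 2 + q.2 ^ 2) - n)])

lemma he_cont_aux (n : ℕ) (p : ℝ × ℝ → ℝ) (hp : Continuous p) (h0 : p 0 = 0) :
    Continuous (fun q => heBump n q * p q) := by
  rw [continuous_iff_continuousAt]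
  intro q
  by_cases hq : q = 0
  · subst hq
    rw [ContinuousAt, h0, mul_zero]
    apply squeeze_zero_norm (a := fun q => ‖p q‖)
    · intro q
      rw [norm_mul, Real.norm_of_nonneg (heBump_nonneg n q)]
      exact mul_le_of_le_one_left (norm_nonneg _) (heBump_le n q)
    · have := (hp.norm).tendsto 0
      simpa [h0] using this
  · have : q.1 ^ 2 + q.2 ^ 2 ≠ 0 := by
      intro h
      apply hq
      have h1 : q.1 = 0 := by nlinarith [sq_nonneg q.1, sq_nonneg q.2]
      have h2 : q.2 = 0 := by nlinarith [sq_nonneg q.1, sq_nonneg q.2]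
      exact Prod.ext h1 h2
    unfold heBump
    fun_prop (disch := assumption)

lemma heRc_cont (n : ℕ) : Continuous (heRc n) := by
  have := he_cont_aux n Prod.fst continuous_fst rfl
  unfold heRc
  fun_prop

lemma heRs_cont (n : ℕ) : Continuous (heRs n) := by
  have := he_cont_aux n Prod.snd continuous_snd rfl
  unfold heRs
  fun_prop

lemma circ_eq {k : ℕ} (hk : 1 ≤ k) {q : ℝ × ℝ} (hq : q ∈ circ k) :
    k * (q.1 ^ 2 + q.2 ^ 2) = 2 * q.1 := by
  have hk' : (k : ℝ) ≠ 0 := by positivity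
  have : (q.1 - 1 / k) ^ 2 + q.2 ^ 2 = (1 / (k : ℝ)) ^ 2 := hq
  field_simp at this
  have h2 : (k : ℝ) * (k * (q.1 ^ 2 + q.2 ^ 2)) = k * (2 * q.1) := by linarith
  exact mul_left_cancel₀ hk' h2

lemma circ_zero_or {k : ℕ} (hk : 1 ≤ k) {q : ℝ × ℝ} (hq : q ∈ circ k) (n : ℕ) :
    q = 0 ∨ heBump n q = if n = k then 1 else 0 := by
  by_cases h0 : q = 0
  · exact Or.inl h0
  right
  have hne : q.1 ^ 2 + q.2 ^ 2 ≠ 0 := by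
    intro h
    apply h0
    have h1 : q.1 = 0 := by nlinarith [sq_nonneg q.1, sq_nonneg q.2]
    have h2 : q.2 = 0 := by nlinarith [sq_nonneg q.1, sq_nonneg q.2]
    exact Prod.ext h1 h2
  have : 2 * q.1 / (q.1 ^ 2 + q.2 ^ 2) = k := by
    rw [div_eq_iff hne, circ_eq hk hq]
  unfold heBump
  rw [this]
  split_ifs with h
  · subst h; simp
  · apply max_eq_left
    have h1 : (1 : ℤ) ≤ |(k : ℤ) - n| := Int.one_le_abs (by omega)
    have h2 : (1 : ℝ) ≤ |(k : ℝ) - n| := by exact_mod_cast h1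
    linarith

lemma heRc_circ {k : ℕ} (hk : 1 ≤ k) {q : ℝ × ℝ} (hq : q ∈ circ k) (n : ℕ) :
    heRc n q = if n = k then 1 - n * q.1 else 1 := by
  rcases circ_zero_or hk hq n with h | h
  · subst h; simp [heRc]
  · unfold heRc
    rw [h]
    split_ifs <;> simp

lemma heRs_circ {k : ℕ} (hk : 1 ≤ k) {q : ℝ × ℝ} (hq : q ∈ circ k) (n : ℕ) :
    heRs n q = if n = k then - (n * q.2) else 0 := by
  rcases circ_zero_or hk hq n with h | h
  · subst h; simp [heRs]
  · unfold heRs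
    rw [h]
    split_ifs <;> simp

lemma HE_circ (q : HE) : ∃ k : ℕ, 1 ≤ k ∧ (q : ℝ × ℝ) ∈ circ k := by
  have := q.2
  simp only [HE, Set.mem_iUnion] at this
  obtain ⟨k, h1, h2⟩ := this
  exact ⟨k, h1, h2⟩

lemma circ_HE {q : ℝ × ℝ} {k : ℕ} (hk : 1 ≤ k) (h : q ∈ circ k) : q ∈ HE := by
  simp only [HE, Set.mem_iUnion]
  exact ⟨k, hk, h⟩

lemma he_sq (n : ℕ) (q : HE) : heRc n q ^ 2 + heRs n q ^ 2 = 1 := by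
  obtain ⟨k, hk, hq⟩ := HE_circ q
  rw [heRc_circ hk hq, heRs_circ hk hq]
  split_ifs with h
  · subst h
    have := circ_eq hk hq
    linear_combination (n : ℝ) * this
  · norm_num

lemma he_or {n : ℕ} (hn : 2 ≤ n) (q : HE) : heRc 1 q = 1 ∨ heRc n q = 1 := by
  obtain ⟨k, hk, hq⟩ := HE_circ q
  rw [heRc_circ hk hq, heRc_circ hk hq]
  by_cases h : k = 1
  · right; rw [if_neg (by omega)]
  · left; rw [if_neg (by omega)]

lemma heRc_hep (n : ℕ) : heRc n hep = 1 := by simp [heRc, hep]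
lemma heRs_hep (n : ℕ) : heRs n hep = 0 := by simp [heRs, hep]

/-- point on the circle `k` at angle `θ` -/
def hePt (k : ℕ) (θ : ℝ) : ℝ × ℝ := (1 / (k : ℝ)) • (1 - Real.cos θ, - Real.sin θ)

lemma hePt_circ {k : ℕ} (hk : 1 ≤ k) (θ : ℝ) : hePt k θ ∈ circ k := by
  have hk' : (k : ℝ) ≠ 0 := by positivity
  simp only [circ, hePt, Set.mem_ofPred_eq, Prod.smul_mk, smul_eq_mul]
  field_simp
  linear_combination Real.sin_sq_add_cos_sq θ

lemma hePt_zero {k : ℕ} {θ : ℝ} (h : Real.cos θ = 1) : hePt k θ = 0 := by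
  have : Real.sin θ = 0 := by
    have := Real.sin_sq_add_cos_sq θ
    rw [h] at this
    nlinarith
  simp [hePt, h, this]

lemma heRc_pt {k : ℕ} (hk : 1 ≤ k) (θ : ℝ) (n : ℕ) :
    heRc n (hePt k θ) = if n = k then Real.cos θ else 1 := by
  have hk' : (k : ℝ) ≠ 0 := by positivity
  rw [heRc_circ hk (hePt_circ hk θ)]
  split_ifs with h
  · subst h; simp [hePt]; field_simp; ring
  · rfl

lemma heRs_pt {k : ℕ} (hk : 1 ≤ k) (θ : ℝ) (n : ℕ) :
    heRs n (hePt k θ) = if n = k then Real.sin θ else 0 := by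
  have hk' : (k : ℝ) ≠ 0 := by positivity
  rw [heRs_circ hk (hePt_circ hk θ)]
  split_ifs with h
  · subst h; simp [hePt]; field_simp
  · rfl

/-- `φ` records the winding of the pair of half-angle cosines along the path `f` -/
structure HeLD (n : ℕ) (f : unitInterval → HE) (φ θ η : unitInterval → ℝ) : Prop where
  cφ : Continuous φ
  cθ : Continuous θ
  cη : Continuous η
  φ0 : φ 0 = Real.pi / 4
  θ0 : θ 0 = 0
  η0 : η 0 = 0
  cosθ : ∀ t, Real.cos (θ t) = heRc 1 (f t)
  sinθ : ∀ t, Real.sin (θ t) = heRs 1 (f t)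
  cosη : ∀ t, Real.cos (η t) = heRc n (f t)
  sinη : ∀ t, Real.sin (η t) = heRs n (f t)
  pol : ∀ t, ∃ r : ℝ, 0 < r ∧ Real.cos (θ t / 2) = r * Real.cos (φ t) ∧
    Real.cos (η t / 2) = r * Real.sin (φ t)

lemma he_half (θ : ℝ) : 2 * Real.cos (θ / 2) ^ 2 = 1 + Real.cos θ := by
  have := Real.cos_sq (θ / 2)
  rw [show 2 * (θ / 2) = θ by ring] at this
  linarith

open unitInterval in
lemma he_exists (n : ℕ) (hn : 2 ≤ n) : ∃ e : LoopSp HE hep → ℝ, Continuous e ∧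
    ∀ f : LoopSp HE hep, ∃ φ θ η, HeLD n f.1 φ θ η ∧ φ 1 = e f := by
  have hev : Continuous (fun x : I × LoopSp HE hep => ((x.2.1 x.1 : HE) : ℝ × ℝ)) := by
    fun_prop
  have ang : ∀ k : ℕ, ∃ θ : C(I × LoopSp HE hep, ℝ), (∀ y, θ (0, y) = 0) ∧
      ∀ x, Real.cos (θ x) = heRc k (x.2.1 x.1) ∧ Real.sin (θ x) = heRs k (x.2.1 x.1) := by
    intro k
    obtain ⟨θ, h0, h⟩ := he_lift (A := LoopSp HE hep)
      ⟨fun x => heRc k (x.2.1 x.1), (heRc_cont k).comp hev⟩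
      ⟨fun x => heRs k (x.2.1 x.1), (heRs_cont k).comp hev⟩ (by
        intro x
        by_contra hcon
        push Not at hcon
        have := he_sq k (x.2.1 x.1)
        simp only [ContinuousMap.coe_mk] at hcon
        rw [hcon.1, hcon.2] at this
        norm_num at this) 1 0 one_pos
      (by intro y; simp [y.2.1, heRc_hep]) (by intro y; simp [y.2.1, heRs_hep])
    refine ⟨θ, h0, fun x => ?_⟩
    obtain ⟨r, hr, h1, h2⟩ := h x
    simp only [ContinuousMap.coe_mk] at h1 h2
    have h3 := he_sq k (x.2.1 x.1)
    rw [h1, h2] at h3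
    have h4 := Real.sin_sq_add_cos_sq (θ x)
    have : r ^ 2 = 1 := by linear_combination h3 - r ^ 2 * h4
    have hr1 : r = 1 := by nlinarith
    rw [h1, h2, hr1]
    simp
  obtain ⟨θ, hθ0, hθ⟩ := ang 1
  obtain ⟨η, hη0, hη⟩ := ang n
  obtain ⟨φ, hφ0, hφ⟩ := he_lift (A := LoopSp HE hep)
    ⟨fun x => Real.cos (θ x / 2), by fun_prop⟩ ⟨fun x => Real.cos (η x / 2), by fun_prop⟩ (by
      intro x
      simp only [ContinuousMap.coe_mk]
      rcases he_or hn (x.2.1 x.1) with h | h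
      · left
        intro h0
        have := he_half (θ x)
        rw [h0, (hθ x).1, h] at this
        norm_num at this
      · right
        intro h0
        have := he_half (η x)
        rw [h0, (hη x).1, h] at this
        norm_num at this) (√2) (Real.pi / 4) (by positivity)
    (by
      intro y
      simp only [ContinuousMap.coe_mk, hθ0, Real.cos_pi_div_four]
      have : √2 * √2 = (2 : ℝ) := Real.mul_self_sqrt (by norm_num)
      simp; linarith)
    (by
      intro y
      simp only [ContinuousMap.coe_mk, hη0, Real.sin_pi_div_four]
      have : √2 * √2 = (2 : ℝ) := Real.mul_self_sqrt (by norm_num)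
      simp; linarith)
  refine ⟨fun f => φ (1, f), by fun_prop, fun f => ⟨fun t => φ (t, f), fun t => θ (t, f),
    fun t => η (t, f), ?_, rfl⟩⟩
  exact ⟨by fun_prop, by fun_prop, by fun_prop, hφ0 f, hθ0 f, hη0 f, fun t => (hθ (t, f)).1,
    fun t => (hθ (t, f)).2, fun t => (hη (t, f)).1, fun t => (hη (t, f)).2, fun t => hφ (t, f)⟩

lemma HeLD.end_eq {n : ℕ} {f : unitInterval → HE} {φ θ η : unitInterval → ℝ}
    (h : HeLD n f φ θ η) (hf : f 1 = hep) : Real.sin (2 * φ 1 + Real.pi / 2) = 0 := by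
  have h1 := h.cosθ 1
  have h2 := h.cosη 1
  rw [hf, heRc_hep] at h1 h2
  obtain ⟨r, hr, h3, h4⟩ := h.pol 1
  have h5 := he_half (θ 1)
  have h6 := he_half (η 1)
  rw [h1, h3] at h5
  rw [h2, h4] at h6
  rw [Real.sin_add_pi_div_two, Real.cos_two_mul']
  have : r ^ 2 * (Real.cos (φ 1) ^ 2 - Real.sin (φ 1) ^ 2) = 0 := by
    linear_combination (h5 - h6) / 2
  rcases mul_eq_zero.1 this with h | h
  · exact absurd h (by positivity)
  · exact h

lemma HeLD.cos_ne {n : ℕ} {f : unitInterval → HE} {φ θ η : unitInterval → ℝ}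
    (h : HeLD n f φ θ η) (t : unitInterval) (ht : heRc 1 (f t) ≠ -1) : Real.cos (φ t) ≠ 0 := by
  intro h0
  apply ht
  obtain ⟨r, hr, h3, h4⟩ := h.pol t
  have h5 := he_half (θ t)
  rw [h3, h0, h.cosθ] at h5
  linarith

lemma HeLD.sin_ne {n : ℕ} {f : unitInterval → HE} {φ θ η : unitInterval → ℝ}
    (h : HeLD n f φ θ η) (t : unitInterval) (ht : heRc n (f t) = 1) : Real.sin (φ t) ≠ 0 := by
  intro h0
  obtain ⟨r, hr, h3, h4⟩ := h.pol t
  have h5 := he_half (η t)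
  rw [h4, h0, h.cosη, ht] at h5
  norm_num at h5

lemma he_bound (f : C(unitInterval, HE)) : ∃ K : ℝ, ∀ n : ℕ, 2 ≤ n → ∀ φ : unitInterval → ℝ,
    Continuous φ → (∀ t, heRc 1 (f t) ≠ -1 → Real.cos (φ t) ≠ 0) →
    (∀ t, heRc n (f t) = 1 → Real.sin (φ t) ≠ 0) → |φ 1 - φ 0| ≤ K := by
  have hc : Continuous (fun t => heRc 1 (f t)) :=
    (heRc_cont 1).comp (continuous_subtype_val.comp f.continuous)
  obtain ⟨t, t0, tm, ⟨N, hN⟩, ht⟩ := exists_monotone_Icc_subset_open_cover_unitInterval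
    (c := fun b : Bool => if b then {t | heRc 1 (f t) ≠ -1} else {t | heRc 1 (f t) ≠ 1})
    (by
      intro b
      cases b
      · simpa using isOpen_ne_fun hc continuous_const
      · simpa using isOpen_ne_fun hc continuous_const)
    (by
      intro s _
      rw [Set.mem_iUnion]
      by_cases h : heRc 1 (f s) = -1
      · refine ⟨false, ?_⟩
        simp [h]; norm_num
      · refine ⟨true, ?_⟩
        simp [h])
  refine ⟨N * Real.pi, fun n hn φ hφ h1 h2 => ?_⟩
  have step : ∀ j, |φ (t (j + 1)) - φ (t j)| ≤ Real.pi := by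
    intro j
    have hj : t j ≤ t (j + 1) := tm (Nat.le_succ j)
    obtain ⟨b, hb⟩ := ht j
    have hpre : IsPreconnected (Set.Icc (t j) (t (j + 1))) := isPreconnected_Icc
    cases b
    · refine he_var _ hpre φ hφ.continuousOn 0 (fun x hx => ?_) _ _ (Set.right_mem_Icc.2 hj)
        (Set.left_mem_Icc.2 hj)
      have := hb hx
      simp only [Bool.false_eq_true, if_false] at this
      rw [add_zero]
      exact h2 x ((he_or hn (f x)).resolve_left this)
    · refine he_var _ hpre φ hφ.continuousOn (Real.pi / 2) (fun x hx => ?_) _ _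
        (Set.right_mem_Icc.2 hj) (Set.left_mem_Icc.2 hj)
      have := hb hx
      simp only [if_true] at this
      rw [Real.sin_add_pi_div_two]
      exact h1 x this
  have tot : ∀ j : ℕ, |φ (t j) - φ 0| ≤ j * Real.pi := by
    intro j
    induction j with
    | zero => simp [t0]
    | succ j ih =>
      have := abs_add_le (φ (t (j + 1)) - φ (t j)) (φ (t j) - φ 0)
      rw [sub_add_sub_cancel] at this
      have := step j
      push_cast
      linarith
  have := tot N
  rwa [hN N le_rfl] at this

/-- clamp to `[-1,1]` -/
def heCl (x : ℝ) : ℝ := max (-1) (min 1 (2 * x))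

lemma heCl_cont : Continuous heCl := by unfold heCl; fun_prop
lemma heCl_mem (x : ℝ) : -1 ≤ heCl x ∧ heCl x ≤ 1 :=
  ⟨le_max_left _ _, max_le (by norm_num) (min_le_left _ _)⟩
lemma heCl_one {x : ℝ} (h : 1 / 2 ≤ x) : heCl x = 1 := by
  unfold heCl
  rw [min_eq_left (by linarith)]
  norm_num
lemma heCl_neg {x : ℝ} (h : x ≤ -(1 / 2)) : heCl x = -1 := by
  unfold heCl
  rw [min_eq_right (by linarith)]
  exact max_eq_left (by linarith)
lemma heCl_mul (x : ℝ) : 0 ≤ heCl x * x ∧ (x ≠ 0 → 0 < heCl x * x) := by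
  unfold heCl
  rcases lt_trichotomy x 0 with h | h | h
  · rw [min_eq_right (by linarith)]
    have : max (-1) (2 * x) < 0 := max_lt (by norm_num) (by linarith)
    have := mul_pos_of_neg_of_neg this h
    exact ⟨this.le, fun _ => this⟩
  · subst h; simp
  · have : 0 < max (-1) (min 1 (2 * x)) := lt_max_of_lt_right (lt_min one_pos (by linarith))
    have := mul_pos this h
    exact ⟨this.le, fun _ => this⟩

/-- angle whose half has cosine `heCl x` -/
def heAn (x : ℝ) : ℝ := 2 * Real.arccos (heCl x)
lemma heAn_cont : Continuous heAn := by
  have := heCl_cont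
  unfold heAn
  exact continuous_const.mul (Real.continuous_arccos.comp this)
lemma heAn_half (x : ℝ) : Real.cos (heAn x / 2) = heCl x := by
  unfold heAn
  rw [mul_div_cancel_left₀ _ two_ne_zero, Real.cos_arccos (heCl_mem x).1 (heCl_mem x).2]
lemma heAn_zero {x : ℝ} (h : 1 / 2 ≤ x) : heAn x = 0 := by
  unfold heAn; rw [heCl_one h]; simp
lemma heAn_cos {x : ℝ} (h : 1 / 2 ≤ |x|) : Real.cos (heAn x) = 1 := by
  have h1 := he_half (heAn x)
  rw [heAn_half] at h1
  rcases le_abs.1 h with h | h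
  · rw [heCl_one h] at h1; linarith
  · rw [heCl_neg (by linarith)] at h1; linarith
lemma heAn_or (α : ℝ) : Real.cos (heAn (Real.cos α)) = 1 ∨ Real.cos (heAn (Real.sin α)) = 1 := by
  by_cases h : 1 / 2 ≤ |Real.cos α|
  · exact Or.inl (heAn_cos h)
  · right
    apply heAn_cos
    by_contra h'
    push Not at h h'
    have h1 := sq_lt_sq' (by linarith [abs_nonneg (Real.cos α)]) h
    have h2 := sq_lt_sq' (by linarith [abs_nonneg (Real.sin α)]) h'
    rw [sq_abs] at h1 h2
    linarith [Real.sin_sq_add_cos_sq α]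

lemma he_wind {n : ℕ} (hn : 2 ≤ n) (N : ℕ) (g : unitInterval → HE) {φ θ η : unitInterval → ℝ}
    (h : HeLD n g φ θ η)
    (hg : ∀ s : unitInterval, (g s : ℝ × ℝ) =
      hePt 1 (heAn (Real.cos (Real.pi / 4 + 2 * Real.pi * N * s))) +
      hePt n (heAn (Real.sin (Real.pi / 4 + 2 * Real.pi * N * s)))) :
    2 * Real.pi * N - Real.pi ≤ φ 1 - φ 0 := by
  set α : unitInterval → ℝ := fun s => Real.pi / 4 + 2 * Real.pi * N * s with hα
  have hαc : Continuous α := by fun_prop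
  have hn1 : 1 ≤ n := by omega
  have hn2 : n ≠ 1 := by omega
  have hs : ∀ x : ℝ, Real.cos x = 1 → Real.sin x = 0 := by
    intro x hx
    have := Real.sin_sq_add_cos_sq x
    rw [hx] at this
    nlinarith
  have vals : ∀ s, (heRc 1 (g s) = Real.cos (heAn (Real.cos (α s))) ∧
      heRs 1 (g s) = Real.sin (heAn (Real.cos (α s)))) ∧
      (heRc n (g s) = Real.cos (heAn (Real.sin (α s))) ∧
      heRs n (g s) = Real.sin (heAn (Real.sin (α s)))) := by
    intro s
    rw [hg s]
    rcases heAn_or (α s) with h1 | h1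
    · rw [hePt_zero h1, zero_add, heRc_pt hn1, heRs_pt hn1, heRc_pt hn1, heRs_pt hn1,
        if_neg hn2.symm, if_neg hn2.symm, if_pos rfl, if_pos rfl, h1, hs _ h1]
      exact ⟨⟨rfl, rfl⟩, rfl, rfl⟩
    · rw [hePt_zero h1, add_zero, heRc_pt le_rfl, heRs_pt le_rfl, heRc_pt le_rfl, heRs_pt le_rfl,
        if_neg hn2, if_neg hn2, if_pos rfl, if_pos rfl, h1, hs _ h1]
      exact ⟨⟨rfl, rfl⟩, rfl, rfl⟩
  have hα0 : α 0 = Real.pi / 4 := by simp [hα]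
  have hbig : (1 : ℝ) / 2 ≤ √2 / 2 := by
    have : (1 : ℝ) ≤ √2 := Real.one_le_sqrt.2 (by norm_num)
    linarith
  have e1 : ∀ s, θ s = heAn (Real.cos (α s)) := by
    intro s
    have := he_const (fun s => θ s - heAn (Real.cos (α s)))
      (h.cθ.sub (heAn_cont.comp (Real.continuous_cos.comp hαc))) (fun s => by
        rw [Real.sin_sub, h.cosθ, h.sinθ, (vals s).1.1, (vals s).1.2]; ring) s 0
    simp only [h.θ0, hα0, Real.cos_pi_div_four, heAn_zero hbig] at this
    linarith
  have e2 : ∀ s, η s = heAn (Real.sin (α s)) := by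
    intro s
    have := he_const (fun s => η s - heAn (Real.sin (α s)))
      (h.cη.sub (heAn_cont.comp (Real.continuous_sin.comp hαc))) (fun s => by
        rw [Real.sin_sub, h.cosη, h.sinη, (vals s).2.1, (vals s).2.2]; ring) s 0
    simp only [h.η0, hα0, Real.sin_pi_div_four, heAn_zero hbig] at this
    linarith
  have key := he_var Set.univ isPreconnected_univ (fun s => φ s - α s)
    (h.cφ.sub hαc).continuousOn (Real.pi / 2) (fun s _ => by
      rw [Real.sin_add_pi_div_two]
      obtain ⟨r, hr, h3, h4⟩ := h.pol s
      rw [e1, heAn_half] at h3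
      rw [e2, heAn_half] at h4
      have h5 := heCl_mul (Real.cos (α s))
      have h6 := heCl_mul (Real.sin (α s))
      have h7 := Real.sin_sq_add_cos_sq (α s)
      intro h0
      rw [Real.cos_sub] at h0
      have h8 : heCl (Real.cos (α s)) * Real.cos (α s) +
          heCl (Real.sin (α s)) * Real.sin (α s) = 0 := by
        rw [h3, h4]; linear_combination r * h0
      by_cases hc : Real.cos (α s) = 0
      · have : Real.sin (α s) ≠ 0 := by
          intro h9
          rw [hc, h9] at h7
          norm_num at h7
        linarith [h6.2 this, h5.1]
      · linarith [h5.2 hc, h6.1]) 1 0 trivial trivial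
  have hα1 : α 1 = Real.pi / 4 + 2 * Real.pi * N := by simp [hα]
  simp only [hα0, hα1] at key
  have := (abs_le.1 key).1
  linarith

lemma he_joined (H : unitInterval × unitInterval → HE) (hH : Continuous H)
    (h0 : ∀ r, H (r, 0) = hep) (h1 : ∀ r, H (r, 1) = hep) (a b : LoopSp HE hep)
    (ha : ∀ t, a.1 t = H (0, t)) (hb : ∀ t, b.1 t = H (1, t)) : Joined a b := by
  let H' : C(unitInterval × unitInterval, HE) := ⟨H, hH⟩
  refine ⟨⟨⟨fun r => ⟨H'.curry r, h0 r, h1 r⟩, ?_⟩, ?_, ?_⟩⟩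
  · exact Continuous.subtype_mk H'.curry.continuous _
  · apply Subtype.ext
    ext1 t
    exact (ha t).symm
  · apply Subtype.ext
    ext1 t
    exact (hb t).symm

lemma hePt_cont (k : ℕ) : Continuous (hePt k) := by unfold hePt; fun_prop

/-- second-half reparametrisation -/
def heσ (t : unitInterval) : unitInterval := Set.projIcc 0 1 zero_le_one (2 * (t : ℝ) - 1)
lemma heσ_cont : Continuous heσ := by unfold heσ; fun_prop
lemma heσ_zero {t : unitInterval} (h : (t : ℝ) ≤ 1 / 2) : heσ t = 0 :=
  Set.projIcc_of_le_left _ (by linarith)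
lemma heσ_one : heσ 1 = 1 := Set.projIcc_of_right_le _ (by norm_num)

/-- the phase: runs `N` times round in the first half -/
def heα (N : ℕ) (t : unitInterval) : ℝ := Real.pi / 4 + 2 * Real.pi * N * min 1 (2 * (t : ℝ))
lemma heα_cont (N : ℕ) : Continuous (heα N) := by unfold heα; fun_prop
lemma heα_ends (N : ℕ) (t : unitInterval) (h : (t : ℝ) = 0 ∨ 1 / 2 ≤ (t : ℝ)) :
    heAn (Real.cos (heα N t)) = 0 ∧ heAn (Real.sin (heα N t)) = 0 := by
  have hbig : (1 : ℝ) / 2 ≤ √2 / 2 := by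
    have : (1 : ℝ) ≤ √2 := Real.one_le_sqrt.2 (by norm_num)
    linarith
  have : Real.cos (heα N t) = √2 / 2 ∧ Real.sin (heα N t) = √2 / 2 := by
    unfold heα
    rcases h with h | h
    · simp [h]
    · rw [min_eq_left (by linarith), mul_one, mul_comm (2 * Real.pi) (N : ℝ),
        Real.cos_add_nat_mul_two_pi, Real.sin_add_nat_mul_two_pi]
      simp
  rw [this.1, this.2]
  exact ⟨heAn_zero hbig, heAn_zero hbig⟩

lemma hep_val : ((hep : HE) : ℝ × ℝ) = 0 := rfl

lemma hePt_at_zero (k : ℕ) : hePt k 0 = 0 := hePt_zero Real.cos_zero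

/-- the approximating loops as maps into the plane -/
def heG (N : ℕ) (f : LoopSp HE hep) (k : ℕ) (t : unitInterval) : ℝ × ℝ :=
  (f.1 (heσ t) : ℝ × ℝ) + hePt 1 (heAn (Real.cos (heα N t))) +
    hePt k (heAn (Real.sin (heα N t)))

lemma heG_cont (N : ℕ) (f : LoopSp HE hep) (k : ℕ) : Continuous (heG N f k) := by
  have h1 := heσ_cont
  have h2 := heα_cont N
  have h3 := heAn_cont
  have h4 := hePt_cont
  unfold heG
  have h5 : Continuous (fun t => f.1 (heσ t)) := f.1.continuous.comp h1
  exact ((continuous_subtype_val.comp h5).add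
    ((h4 1).comp (h3.comp (Real.continuous_cos.comp h2)))).add
    ((h4 k).comp (h3.comp (Real.continuous_sin.comp h2)))

lemma heG_half (N : ℕ) (f : LoopSp HE hep) (k : ℕ) {t : unitInterval} (ht : (t : ℝ) ≤ 1 / 2) :
    heG N f k t = hePt 1 (heAn (Real.cos (heα N t))) + hePt k (heAn (Real.sin (heα N t))) := by
  unfold heG
  rw [heσ_zero ht, f.2.1, hep_val, zero_add]

lemma heG_half' (N : ℕ) (f : LoopSp HE hep) (k : ℕ) {t : unitInterval}
    (ht : (t : ℝ) = 0 ∨ 1 / 2 ≤ (t : ℝ)) : heG N f k t = f.1 (heσ t) := by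
  unfold heG
  rw [(heα_ends N t ht).1, (heα_ends N t ht).2, hePt_at_zero, hePt_at_zero, add_zero, add_zero]

lemma heG_mem (N : ℕ) (f : LoopSp HE hep) (k : ℕ) (hk : 1 ≤ k) (t : unitInterval) :
    heG N f k t ∈ HE := by
  rcases le_total (t : ℝ) (1 / 2) with ht | ht
  · rw [heG_half N f k ht]
    rcases heAn_or (heα N t) with h | h
    · rw [hePt_zero h, zero_add]
      exact circ_HE hk (hePt_circ hk _)
    · rw [hePt_zero h, add_zero]
      exact circ_HE le_rfl (hePt_circ le_rfl _)
  · rw [heG_half' N f k (Or.inr ht)]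
    exact (f.1 (heσ t)).2

/-- the approximating loops -/
def heF (N : ℕ) (f : LoopSp HE hep) (k : ℕ) (hk : 1 ≤ k) : LoopSp HE hep :=
  ⟨⟨fun t => ⟨heG N f k t, heG_mem N f k hk t⟩, (heG_cont N f k).subtype_mk _⟩, by
    constructor
    · apply Subtype.ext
      change heG N f k 0 = _
      rw [heG_half' N f k (Or.inl rfl), heσ_zero (by norm_num), f.2.1]
    · apply Subtype.ext
      change heG N f k 1 = _
      rw [heG_half' N f k (Or.inr (by norm_num)), heσ_one, f.2.2]⟩

/-- homotopy killing the first circle -/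
def heH (N : ℕ) (f : LoopSp HE hep) (x : unitInterval × unitInterval) : ℝ × ℝ :=
  (f.1 (heσ x.2) : ℝ × ℝ) + hePt 1 (x.1 * heAn (Real.cos (heα N x.2)))

lemma heH_cont (N : ℕ) (f : LoopSp HE hep) : Continuous (heH N f) := by
  unfold heH
  have h5 : Continuous (fun x : unitInterval × unitInterval => f.1 (heσ x.2)) :=
    f.1.continuous.comp (heσ_cont.comp continuous_snd)
  have h6 : Continuous (fun x : unitInterval × unitInterval =>
      (x.1 : ℝ) * heAn (Real.cos (heα N x.2))) :=
    (continuous_subtype_val.comp continuous_fst).mul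
      (heAn_cont.comp (Real.continuous_cos.comp ((heα_cont N).comp continuous_snd)))
  exact (continuous_subtype_val.comp h5).add ((hePt_cont 1).comp h6)

lemma heH_half' (N : ℕ) (f : LoopSp HE hep) (x : unitInterval × unitInterval)
    (ht : (x.2 : ℝ) = 0 ∨ 1 / 2 ≤ (x.2 : ℝ)) : heH N f x = f.1 (heσ x.2) := by
  unfold heH
  rw [(heα_ends N x.2 ht).1, mul_zero, hePt_at_zero, add_zero]

lemma heH_mem (N : ℕ) (f : LoopSp HE hep) (x : unitInterval × unitInterval) : heH N f x ∈ HE := by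
  rcases le_total (x.2 : ℝ) (1 / 2) with ht | ht
  · unfold heH
    rw [heσ_zero ht, f.2.1, hep_val, zero_add]
    exact circ_HE le_rfl (hePt_circ le_rfl _)
  · rw [heH_half' N f x (Or.inr ht)]
    exact (f.1 _).2

lemma heH_zero (N : ℕ) (f : LoopSp HE hep) (r : unitInterval) : heH N f (r, 0) = 0 := by
  rw [heH_half' N f _ (Or.inl rfl)]
  change ((f.1 (heσ 0) : HE) : ℝ × ℝ) = 0
  rw [heσ_zero (by norm_num), f.2.1]
  rfl

lemma heH_one (N : ℕ) (f : LoopSp HE hep) (r : unitInterval) : heH N f (r, 1) = 0 := by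
  rw [heH_half' N f _ (Or.inr (by norm_num))]
  change ((f.1 (heσ 1) : HE) : ℝ × ℝ) = 0
  rw [heσ_one, f.2.2]
  rfl

/-- the limit loop -/
def heLim (N : ℕ) (f : LoopSp HE hep) : LoopSp HE hep :=
  ⟨⟨fun t => ⟨heH N f (1, t), heH_mem N f (1, t)⟩,
    ((heH_cont N f).comp (by fun_prop)).subtype_mk _⟩,
    Subtype.ext (heH_zero N f 1), Subtype.ext (heH_one N f 1)⟩

lemma heLim_joined (N : ℕ) (f : LoopSp HE hep) : Joined f (heLim N f) := by
  let fσ : LoopSp HE hep := ⟨⟨fun t => f.1 (heσ t), f.1.continuous.comp heσ_cont⟩, by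
    constructor
    · change f.1 (heσ 0) = _
      rw [heσ_zero (by norm_num), f.2.1]
    · change f.1 (heσ 1) = _
      rw [heσ_one, f.2.2]⟩
  have j1 : Joined f fσ := by
    refine he_joined (fun x => f.1 (Set.projIcc 0 1 zero_le_one
      ((1 - (x.1 : ℝ)) * x.2 + x.1 * heσ x.2))) ?_ ?_ ?_ _ _ ?_ ?_
    · have h1 := heσ_cont
      fun_prop
    · intro r
      simp [heσ_zero, f.2.1]
    · intro r
      simp [heσ_one, f.2.2]
    · intro t
      simp
    · intro t
      simp [fσ]
  have j2 : Joined fσ (heLim N f) := by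
    refine he_joined (fun x => ⟨heH N f x, heH_mem N f x⟩) ((heH_cont N f).subtype_mk _)
      (fun r => Subtype.ext (heH_zero N f r)) (fun r => Subtype.ext (heH_one N f r)) _ _ ?_ ?_
    · intro t
      apply Subtype.ext
      simp [fσ, heH, hePt_at_zero]
    · intro t
      rfl
  exact j1.trans j2

lemma heF_tendsto (N : ℕ) (f : LoopSp HE hep) :
    Filter.Tendsto (fun m : ℕ => heF N f (m + 2) (by omega)) Filter.atTop (nhds (heLim N f)) := by
  have hind : Topology.IsInducing (fun g : LoopSp HE hep =>
      (⟨Subtype.val, continuous_subtype_val⟩ : C(HE, ℝ × ℝ)).comp g.1) :=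
    (ContinuousMap.isInducing_postcomp (⟨Subtype.val, continuous_subtype_val⟩ : C(HE, ℝ × ℝ))
      Topology.IsInducing.subtypeVal).comp Topology.IsInducing.subtypeVal
  rw [hind.tendsto_nhds_iff]
  let W : C(ℝ × unitInterval, ℝ × ℝ) := ⟨fun x => heH N f (1, x.2) +
    x.1 • (1 - Real.cos (heAn (Real.sin (heα N x.2))),
      - Real.sin (heAn (Real.sin (heα N x.2)))), by
    have h1 : Continuous (fun x : ℝ × unitInterval => heH N f (1, x.2)) :=
      (heH_cont N f).comp (by fun_prop)
    have h2 : Continuous (fun x : ℝ × unitInterval => heAn (Real.sin (heα N x.2))) :=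
      heAn_cont.comp (Real.continuous_sin.comp ((heα_cont N).comp continuous_snd))
    fun_prop⟩
  have hlim : Filter.Tendsto (fun m : ℕ => 1 / ((m + 2 : ℕ) : ℝ)) Filter.atTop (nhds 0) :=
    tendsto_one_div_atTop_nhds_zero_nat.comp (Filter.tendsto_add_atTop_nat 2)
  have hW := (W.curry.continuous.tendsto 0).comp hlim
  have e0 : (⟨Subtype.val, continuous_subtype_val⟩ : C(HE, ℝ × ℝ)).comp (heLim N f).1
      = W.curry 0 := by
    ext1 t
    simp [W, heLim]
  have e1 : (fun g : LoopSp HE hep =>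
      (⟨Subtype.val, continuous_subtype_val⟩ : C(HE, ℝ × ℝ)).comp g.1) ∘
      (fun m : ℕ => heF N f (m + 2) (by omega)) =
      W.curry ∘ (fun m : ℕ => 1 / ((m + 2 : ℕ) : ℝ)) := by
    funext m
    ext1 t
    change heG N f (m + 2) t = heH N f (1, t) + _
    unfold heG heH
    simp only [Set.Icc.coe_one, one_mul]
    rfl
  rw [e0, e1]
  exact hW

lemma heF_large (N : ℕ) (f : LoopSp HE hep) {n : ℕ} (hn : 2 ≤ n) {K : ℝ}
    (hK : ∀ φ : unitInterval → ℝ,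
      Continuous φ → (∀ t, heRc 1 (f.1 t) ≠ -1 → Real.cos (φ t) ≠ 0) →
      (∀ t, heRc n (f.1 t) = 1 → Real.sin (φ t) ≠ 0) → |φ 1 - φ 0| ≤ K)
    {φ θ η : unitInterval → ℝ}
    (h : HeLD n (heF N f n (by omega)).1 φ θ η) :
    Real.pi / 4 + 2 * Real.pi * N - Real.pi - K ≤ φ 1 := by
  let a : unitInterval → unitInterval := fun s => ⟨(s : ℝ) / 2, by
    have := s.2.1; have := s.2.2; constructor <;> linarith⟩
  let b : unitInterval → unitInterval := fun s => ⟨(1 + (s : ℝ)) / 2, by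
    have := s.2.1; have := s.2.2; constructor <;> linarith⟩
  have ca : Continuous a := Continuous.subtype_mk (by fun_prop) _
  have cb : Continuous b := Continuous.subtype_mk (by fun_prop) _
  have a0 : a 0 = 0 := Subtype.ext (by simp [a])
  have b1 : b 1 = 1 := Subtype.ext (by simp [b])
  have ab : a 1 = b 0 := Subtype.ext (by simp [a, b])
  have hfirst : HeLD n ((heF N f n (by omega)).1 ∘ a) (φ ∘ a) (θ ∘ a) (η ∘ a) :=
    ⟨h.cφ.comp ca, h.cθ.comp ca, h.cη.comp ca, by simp [a0, h.φ0], by simp [a0, h.θ0],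
      by simp [a0, h.η0], fun t => h.cosθ (a t), fun t => h.sinθ (a t), fun t => h.cosη (a t),
      fun t => h.sinη (a t), fun t => h.pol (a t)⟩
  have h1 := he_wind hn N _ hfirst (by
    intro s
    have hs := s.2.2
    change heG N f n (a s) = _
    rw [heG_half N f n (by simp only [a]; linarith)]
    have : heα N (a s) = Real.pi / 4 + 2 * Real.pi * N * s := by
      unfold heα
      simp only [a]
      rw [mul_div_cancel₀ _ (two_ne_zero), min_eq_right hs]
    rw [this])
  have hb : ∀ s, (heF N f n (by omega)).1 (b s) = f.1 s := by
    intro s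
    have hs := s.2.1
    apply Subtype.ext
    change heG N f n (b s) = _
    rw [heG_half' N f n (Or.inr (by simp only [b]; linarith))]
    congr 2
    unfold heσ
    simp only [b]
    rw [show 2 * ((1 + (s : ℝ)) / 2) - 1 = s by ring, Set.projIcc_val]
  have h2 := hK (φ ∘ b) (h.cφ.comp cb)
    (fun t ht => h.cos_ne (b t) (by rw [hb]; exact ht))
    (fun t ht => h.sin_ne (b t) (by rw [hb]; exact ht))
  simp only [Function.comp_apply, a0, b1, ab, h.φ0] at h1 h2
  have := (abs_le.1 h2).1
  linarith

/-- The topological fundamental group `π₁(HE, p)` of the Hawaiian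
earring, endowed with the quotient topology, is not a Baire space. -/
theorem topPi1_HE_not_baireSpace : ¬ BaireSpace (TopPi1 HE hep) := by
  intro hB
  have hex := fun n : ℕ => he_exists (n + 2) (by omega)
  choose e he hLD using hex
  have hinv : ∀ n (f g : LoopSp HE hep), Joined f g → e n f = e n g := by
    intro n f g ⟨p⟩
    have := he_const (fun r => 2 * e n (p r) + Real.pi / 2)
      ((continuous_const.mul ((he n).comp p.continuous)).add continuous_const) (fun r => by
        obtain ⟨φ, θ, η, h, h1⟩ := hLD n (p r)
        have := h.end_eq (p r).2.2
        rwa [h1] at this) 0 1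
    simp only [p.source, p.target] at this
    linarith
  let E : ℕ → TopPi1 HE hep → ℝ := fun n => Quotient.lift (e n) (hinv n)
  have hE : ∀ n, Continuous (E n) := fun n => Continuous.quotient_lift (he n) (hinv n)
  let A : ℕ → Set (TopPi1 HE hep) := fun M => ⋂ n, {q | |E n q| ≤ M}
  have hA : ∀ M, IsClosed (A M) := fun M =>
    isClosed_iInter fun n => isClosed_le ((hE n).abs) continuous_const
  have hU : ⋃ M, A M = Set.univ := by
    rw [Set.eq_univ_iff_forall]
    intro q
    induction q using Quotient.inductionOn with
    | h f =>
      obtain ⟨K, hK⟩ := he_bound f.1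
      obtain ⟨M, hM⟩ := exists_nat_ge (K + Real.pi / 4)
      refine Set.mem_iUnion.2 ⟨M, Set.mem_iInter.2 fun n => ?_⟩
      change |e n f| ≤ M
      obtain ⟨φ, θ, η, h, h1⟩ := hLD n f
      have h2 := hK (n + 2) (by omega) φ h.cφ (fun t => h.cos_ne t) (fun t => h.sin_ne t)
      rw [h.φ0, h1] at h2
      have h3 := abs_sub_abs_le_abs_sub (e n f) (Real.pi / 4)
      rw [abs_of_pos (show 0 < Real.pi / 4 by positivity)] at h3
      linarith
  have : Nonempty (TopPi1 HE hep) :=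
    ⟨Quotient.mk _ ⟨ContinuousMap.const _ hep, rfl, rfl⟩⟩
  obtain ⟨M, q, hq⟩ := nonempty_interior_of_iUnion_of_closed hA hU
  induction q using Quotient.inductionOn with
  | h f =>
    obtain ⟨K, hK⟩ := he_bound f.1
    obtain ⟨N, hN⟩ := exists_nat_gt (M + K + Real.pi)
    have hlim : (Quotient.mk _ f : TopPi1 HE hep) = Quotient.mk _ (heLim N f) :=
      Quotient.sound (heLim_joined N f)
    rw [hlim] at hq
    have hc : Continuous (Quotient.mk (pathSetoid (LoopSp HE hep))) := continuous_quotient_mk'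
    have ht := (hc.tendsto (heLim N f)).comp (heF_tendsto N f)
    obtain ⟨m, hm⟩ := (ht.eventually (isOpen_interior.mem_nhds hq)).exists
    have hm' := Set.mem_iInter.1 (interior_subset hm) m
    change |e m (heF N f (m + 2) _)| ≤ M at hm'
    obtain ⟨φ, θ, η, h, h1⟩ := hLD m (heF N f (m + 2) (by omega))
    have h2 := heF_large N f (by omega) (hK (m + 2) (by omega)) h
    rw [h1] at h2
    have h3 := (abs_le.1 hm').2
    have h4 : (N : ℝ) ≤ 2 * Real.pi * N := by
      have : (0 : ℝ) ≤ N := Nat.cast_nonneg N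
      nlinarith [Real.pi_gt_three]
    linarith [Real.pi_pos]

end
end

section
/- The topological fundamental group π₁(HE,p) of the Hawaiian earring, endowed with the quotient topology, is a T1 space: every one-point subset of π₁(HE,p) is closed. -/
noncomputable section

open Set Topology Filter unitInterval

namespace HEproof

/-- The time of last visit, up to time `s`, of the closed set `N`. -/
def lastT (N : Set I) (s : I) : I := sSup (N ∩ Iic s)

lemma lastT_mem {N : Set I} (hN : IsClosed N) (h0 : (0:I) ∈ N) (s : I) :
    lastT N s ∈ N ∧ lastT N s ≤ s := by
  have : sSup (N ∩ Iic s) ∈ N ∩ Iic s :=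
    (hN.inter isClosed_Iic).csSup_mem ⟨0, h0, s.2.1⟩ (OrderTop.bddAbove _)
  exact this

lemma le_lastT {N : Set I} {s t : I} (ht : t ∈ N) (hts : t ≤ s) : t ≤ lastT N s :=
  le_csSup (OrderTop.bddAbove _) ⟨ht, hts⟩

lemma contraction {X : Type*} [MetricSpace X] (f : C(I, X)) (R : I → I → Prop)
    (hR : Equivalence R) (hcl : IsClosed {q : I × I | R q.1 q.2})
    (hf : ∀ s t, R s t → f s = f t) (h01 : R 0 1)
    (hE : ∀ u ξ r τ' τ : I, R r τ' → (∃ v ≤ u, R v ξ) → (∃ v ≤ u, R v τ) →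
      (∀ t, t ∈ uIcc ξ r ∪ uIcc τ τ' → (∃ v ≤ u, R v t) → t = ξ ∨ t = τ) → R ξ τ) :
    ∃ H : C(I × I, X), (∀ s, H (s, 0) = f 0) ∧ (∀ s, H (s, 1) = f s) ∧
      (∀ u, H (0, u) = f 0) ∧ (∀ u, H (1, u) = f 0) := by
  set N : I → Set I := fun u => {t | ∃ v ≤ u, R v t} with hNdef
  have hN : ∀ u, IsClosed (N u) := by
    intro u
    have h1 : IsClosed ({q : I × I | R q.1 q.2} ∩ Prod.fst ⁻¹' (Iic u)) :=
      hcl.inter (isClosed_Iic.preimage continuous_fst)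
    have h2 := (h1.isCompact.image (continuous_snd (X := I) (Y := I))).isClosed
    convert h2 using 1
    ext t
    simp only [hNdef, mem_ofPred_eq, mem_image, mem_inter_iff, mem_preimage, mem_Iic, Prod.exists]
    constructor
    · rintro ⟨v, hv, hr⟩; exact ⟨v, t, ⟨hr, hv⟩, rfl⟩
    · rintro ⟨v, t', ⟨hr, hv⟩, rfl⟩; exact ⟨v, hv, hr⟩
  have hself : ∀ {u t : I}, t ≤ u → t ∈ N u := fun {u t} h => ⟨t, h, hR.refl t⟩
  have hN0 : ∀ u, (0:I) ∈ N u := fun u => hself u.2.1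
  set T : I → I → I := fun s u => lastT (N u) s with hT
  have hTm : ∀ s u, T s u ∈ N u := fun s u => (lastT_mem (hN u) (hN0 u) s).1
  have hTs : ∀ s u, T s u ≤ s := fun s u => (lastT_mem (hN u) (hN0 u) s).2
  have hTle : ∀ {s u t}, t ∈ N u → t ≤ s → t ≤ T s u := fun h1 h2 => le_lastT h1 h2
  have hA : ∀ u s s', s ≤ s' → f (T s u) = f (T s' u) ∨
      ∃ ξ ∈ Icc s s', ∃ ξ' ∈ Icc s s', f (T s u) = f ξ ∧ f (T s' u) = f ξ' := by
    intro u s s' hss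
    by_cases h : T s' u ≤ s
    · left
      rw [le_antisymm (hTle (hTm s' u) h) (hTle (hTm s u) ((hTs s u).trans hss))]
    · right
      push Not at h
      have hne : (N u ∩ Ici s).Nonempty := ⟨T s' u, hTm s' u, h.le⟩
      have hξ : sInf (N u ∩ Ici s) ∈ N u ∩ Ici s :=
        ((hN u).inter isClosed_Ici).csInf_mem hne (OrderBot.bddBelow _)
      set ξ := sInf (N u ∩ Ici s) with hξd
      have hξle : ∀ t ∈ N u, s ≤ t → ξ ≤ t := fun t h1 h2 =>
        csInf_le (OrderBot.bddBelow _) ⟨h1, h2⟩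
      refine ⟨ξ, ⟨hξ.2, (hξle _ (hTm s' u) h.le).trans (hTs s' u)⟩, T s' u,
        ⟨h.le, hTs s' u⟩, hf _ _ ?_, rfl⟩
      refine hE u (T s u) ξ ξ ξ (hR.refl ξ) (hTm s u) hξ.1 ?_
      intro t ht htN
      rcases ht with ht | ht
      · rw [uIcc_of_le ((hTs s u).trans hξ.2)] at ht
        rcases le_total t s with h1 | h1
        · left; exact le_antisymm (hTle htN h1) ht.1
        · right; exact le_antisymm ht.2 (hξle t htN h1)
      · right; simpa using ht
  have hmono : ∀ {u u'}, u ≤ u' → N u ⊆ N u' := by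
    rintro u u' h t ⟨v, hv, hr⟩; exact ⟨v, hv.trans h, hr⟩
  have hB : ∀ s u u', u ≤ u' → f (T s u) = f (T s u') ∨
      ∃ ξ ∈ Icc u u', ∃ ξ' ∈ Icc u u', f (T s u) = f ξ ∧ f (T s u') = f ξ' := by
    intro s u u' huu
    have hle : T s u ≤ T s u' := hTle (hmono huu (hTm s u)) (hTs s u)
    rcases hle.eq_or_lt with h | h
    · left; rw [h]
    right
    have hnot : T s u' ∉ N u := fun hm => absurd (hTle hm (hTs s u')) (not_le.2 h)
    obtain ⟨r, hr, hRr⟩ := hTm s u'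
    have hrN : r ∉ N u := by
      rintro ⟨v, hv, hvr⟩; exact hnot ⟨v, hv, hR.trans hvr hRr⟩
    have hur : u < r := by
      by_contra hc; exact hrN (hself (not_lt.1 hc))
    have hξu : u ≤ T r u := hTle (hself le_rfl) hur.le
    refine ⟨T r u, ⟨hξu, (hTs r u).trans hr⟩, r, ⟨hur.le, hr⟩, ?_, (hf _ _ hRr).symm⟩
    refine (hf _ _ (hE u (T r u) r (T s u') (T s u) hRr (hTm r u) (hTm s u) ?_)).symm
    intro t ht htN
    rcases ht with ht | ht
    · rw [uIcc_of_le (hTs r u)] at ht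
      left; exact le_antisymm (hTle htN ht.2) ht.1
    · rw [uIcc_of_le hle] at ht
      right; exact le_antisymm (hTle htN (ht.2.trans (hTs s u'))) ht.1
  have huc : UniformContinuous f := CompactSpace.uniformContinuous_of_continuous f.continuous
  have hdist : ∀ {a b c d : I}, c ∈ Icc a b → d ∈ Icc a b → dist c d ≤ dist a b := by
    intro a b c d hc hd
    rw [Subtype.dist_eq, Subtype.dist_eq, Real.dist_eq, Real.dist_eq]
    have h1 : (a:ℝ) ≤ c := hc.1
    have h2 : (c:ℝ) ≤ b := hc.2
    have h3 : (a:ℝ) ≤ d := hd.1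
    have h4 : (d:ℝ) ≤ b := hd.2
    rw [abs_sub_comm (a:ℝ), abs_of_nonneg (by linarith : (0:ℝ) ≤ b - a), abs_le]
    constructor <;> linarith
  have hcont : Continuous (fun q : I × I => f (T q.1 q.2)) := by
    apply UniformContinuous.continuous
    rw [Metric.uniformContinuous_iff] at huc ⊢
    intro ε hε
    obtain ⟨δ, hδ, h⟩ := huc (ε/2) (by positivity)
    refine ⟨δ, hδ, ?_⟩
    rintro ⟨s, u⟩ ⟨s', u'⟩ hd
    have hd1 : dist s s' < δ := lt_of_le_of_lt (le_max_left _ _) hd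
    have hd2 : dist u u' < δ := lt_of_le_of_lt (le_max_right _ _) hd
    have key : ∀ (x y : X) (a b : I), dist a b < δ → (x = y ∨
        ∃ ξ ∈ Icc a b, ∃ ξ' ∈ Icc a b, x = f ξ ∧ y = f ξ') → dist x y < ε / 2 := by
      rintro x y a b hab (rfl | ⟨ξ, h1, ξ', h2, rfl, rfl⟩)
      · simpa using by positivity
      · exact h (lt_of_le_of_lt (hdist h1 h2) hab)
    have e1 : dist (f (T s u)) (f (T s' u)) < ε / 2 := by
      rcases le_total s s' with hh | hh
      · exact key _ _ s s' hd1 (hA u s s' hh)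
      · rw [dist_comm]; rw [dist_comm] at hd1; exact key _ _ s' s hd1 (hA u s' s hh)
    have e2 : dist (f (T s' u)) (f (T s' u')) < ε / 2 := by
      rcases le_total u u' with hh | hh
      · exact key _ _ u u' hd2 (hB s' u u' hh)
      · rw [dist_comm]; rw [dist_comm] at hd2; exact key _ _ u' u hd2 (hB s' u' u hh)
    calc dist (f (T s u)) (f (T s' u')) ≤ _ := dist_triangle _ (f (T s' u)) _
      _ < ε := by linarith
  refine ⟨⟨_, hcont⟩, ?_, ?_, ?_, ?_⟩
  · intro s
    obtain ⟨v, hv, hr⟩ := hTm s 0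
    have : v = 0 := le_antisymm hv v.2.1
    subst this
    exact (hf _ _ hr).symm
  · intro s
    change f (T s 1) = f s
    rw [le_antisymm (hTs s 1) (hTle (hself s.2.2) le_rfl)]
  · intro u
    change f (T 0 u) = f 0
    rw [le_antisymm (hTs 0 u) (hTle (hN0 u) le_rfl)]
  · intro u
    change f (T 1 u) = f 0
    rw [le_antisymm (hTs 1 u) (hTle ⟨0, u.2.1, h01⟩ le_rfl)]
    exact (hf _ _ h01).symm

end HEproof

namespace HEproof

/-- Multiplying on the left by a letter. -/
lemma toWord_letter_mul {α : Type*} [DecidableEq α] (l : α × Bool) (h : FreeGroup α) :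
    (∃ tl, h.toWord = (l.1, !l.2) :: tl ∧ (FreeGroup.mk [l] * h).toWord = tl) ∨
    (FreeGroup.mk [l] * h).toWord = l :: h.toWord := by
  have e : (FreeGroup.mk [l] * h).toWord = FreeGroup.reduce (l :: h.toWord) := by
    conv_lhs => rw [← FreeGroup.mk_toWord (x := h)]
    rw [FreeGroup.mul_mk, FreeGroup.toWord_mk]; rfl
  rw [e, FreeGroup.reduce.cons, FreeGroup.reduce_toWord]
  rcases hw : h.toWord with _ | ⟨hd, tl⟩
  · right; rfl
  · by_cases hc : l.1 = hd.1 ∧ l.2 = !hd.2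
    · left
      refine ⟨tl, ?_, ?_⟩
      · obtain ⟨a, b⟩ := hd; obtain ⟨c, d⟩ := l
        simp at hc ⊢; simp [hc.1, hc.2]
      · simp only [if_pos hc]
    · right; simp only [if_neg hc]

/-- crossing an edge of the Cayley tree. -/
lemma crossing_edge {α : Type*} [DecidableEq α] (l l' : α × Bool) (L : List (α × Bool))
    (h : FreeGroup α)
    (h1 : (l :: L) <:+ h.toWord) (h2 : ¬ (l :: L) <:+ (FreeGroup.mk [l'] * h).toWord) :
    h = FreeGroup.mk (l :: L) ∧ l' = (l.1, !l.2) ∧ FreeGroup.mk [l'] * h = FreeGroup.mk L := by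
  rcases toWord_letter_mul l' h with ⟨tl, e1, e2⟩ | e
  · rw [e1, List.suffix_cons_iff] at h1
    rcases h1 with h1 | h1
    · rw [← h1] at e1
      simp only [List.cons.injEq] at h1
      refine ⟨?_, ?_, ?_⟩
      · rw [← e1, FreeGroup.mk_toWord]
      · rw [h1.1]; simp
      · rw [h1.2, ← e2, FreeGroup.mk_toWord]
    · exact absurd (e2 ▸ h1) h2
  · rw [e] at h2
    exact absurd (h1.trans (List.suffix_cons _ _)) h2

/-- A local cocycle. -/
def IsCocyc {X G : Type*} [TopologicalSpace X] [Group G] (g : X → X → G) : Prop :=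
  ∀ x, ∃ V : Set X, IsOpen V ∧ x ∈ V ∧ ∃ β : X → G, ∀ a ∈ V, ∀ b ∈ V, g a b = β b * (β a)⁻¹

/-- Lift of a map along a cocycle. -/
def IsLift {T X G : Type*} [TopologicalSpace T] [Group G] (g : X → X → G) (f : T → X)
    (W : T → G) : Prop :=
  ∀ s, ∀ᶠ t in 𝓝 s, W t = g (f s) (f t) * W s

lemma IsLift.comp {T T' X G : Type*} [TopologicalSpace T] [TopologicalSpace T'] [Group G]
    {g : X → X → G} {f : T → X} {W : T → G} (h : IsLift g f W) {φ : T' → T}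
    (hφ : Continuous φ) : IsLift g (f ∘ φ) (W ∘ φ) := fun s =>
  (hφ.tendsto s).eventually (h (φ s))

lemma IsLift.unique {T X G : Type*} [TopologicalSpace T] [PreconnectedSpace T] [Group G]
    {g : X → X → G} {f : T → X} {W W' : T → G} (h : IsLift g f W) (h' : IsLift g f W')
    (s t : T) : (W s)⁻¹ * W' s = (W t)⁻¹ * W' t := by
  have : IsLocallyConstant (fun s => (W s)⁻¹ * W' s) := by
    rw [IsLocallyConstant.iff_eventually_eq]
    intro s
    filter_upwards [h s, h' s] with t h1 h2
    rw [h1, h2]; group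
  exact this.apply_eq_of_preconnectedSpace s t

lemma IsLift.unique' {T X G : Type*} [TopologicalSpace T] [PreconnectedSpace T] [Group G]
    {g : X → X → G} {f : T → X} {W W' : T → G} (h : IsLift g f W) (h' : IsLift g f W')
    {s : T} (hs : W s = W' s) (t : T) : W t = W' t := by
  have := h.unique h' s t
  rw [hs, inv_mul_cancel] at this
  exact inv_mul_eq_one.1 this.symm

theorem exists_lift {X G A : Type*} [TopologicalSpace X] [Group G] [TopologicalSpace A]
    (g : X → X → G) (hg : IsCocyc g) (p : X) (H : C(I × A, X)) (H0 : ∀ a, H (0, a) = p) :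
    ∃ w : I × A → G, (∀ a, w (0, a) = 1) ∧ IsLift g H w := by
  let _ : TopologicalSpace G := ⊥
  have : DiscreteTopology G := ⟨rfl⟩
  choose V hVo hV β hβ using hg
  let Z : FiberBundleCore X X G :=
    { baseSet := V
      isOpen_baseSet := hVo
      indexAt := id
      mem_baseSet_at := hV
      coordChange := fun i j x v => (β j x)⁻¹ * β i x * v
      coordChange_self := by intro i x _ v; simp
      continuousOn_coordChange := by
        intro i j
        rintro ⟨x, v⟩ ⟨⟨hi, hj⟩, -⟩
        have : ContinuousWithinAt (fun q : X × G => (β j x)⁻¹ * β i x * q.2)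
            ((V i ∩ V j) ×ˢ univ) (x, v) :=
          (continuous_of_discreteTopology.comp continuous_snd).continuousWithinAt
        refine this.congr ?_ rfl
        rintro ⟨y, v'⟩ ⟨⟨hi', hj'⟩, -⟩
        have h1 := hβ i x hi y hi'
        have h2 := hβ j x hj y hj'
        have h3 : β i y = β j y * (β j x)⁻¹ * β i x := by rw [← h2, h1]; group
        simp only [h3]; group
      coordChange_comp := by intro i j k x _ v; group }
  have cov : IsCoveringMap Z.proj := FiberBundle.isCoveringMap (F := G) (E := Z.Fiber)
  let e0 : Z.TotalSpace := ⟨p, ((β p p)⁻¹ : G)⟩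
  let K := cov.liftHomotopy H (.const A e0) (fun a => H0 a)
  have hK : ∀ q, (K q).1 = H q := fun q =>
    congrFun (cov.liftHomotopy_lifts H (.const A e0) (fun a => H0 a)) q
  have hK0 : ∀ a, K (0, a) = e0 := fun a =>
    cov.liftHomotopy_zero H (.const A e0) (fun a => H0 a) a
  let k : I × A → G := fun q => (K q).2
  have hk0 : ∀ a, k (0, a) = (β p p)⁻¹ := by
    intro a
    change (K (0, a)).2 = _
    rw [hK0]
  refine ⟨fun q => β (H q) (H q) * k q, ?_, ?_⟩
  · intro a
    change β (H (0, a)) (H (0, a)) * k (0, a) = 1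
    rw [hk0, H0, mul_inv_cancel]
  · intro q
    have hc : ContinuousAt (fun q' => (Z.localTriv (H q) (K q')).2) q := by
      have : ContinuousAt (Z.localTriv (H q)) (K q) := by
        apply (Z.localTriv (H q)).continuousAt
        rw [Z.mem_localTriv_source, hK]; exact hV _
      exact continuous_snd.continuousAt.comp (this.comp K.continuous.continuousAt)
    have hev : ∀ᶠ q' in 𝓝 q, (Z.localTriv (H q) (K q')).2 = (Z.localTriv (H q) (K q)).2 :=
      hc.eventually (mem_nhds_discrete.2 rfl : {(Z.localTriv (H q) (K q)).2} ∈ 𝓝 _)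
    have hev2 : ∀ᶠ q' in 𝓝 q, H q' ∈ V (H q) :=
      H.continuous.continuousAt.eventually ((hVo _).mem_nhds (hV _))
    filter_upwards [hev, hev2] with q' h1 h2
    have h1' : (β (H q) (K q').1)⁻¹ * β (K q').1 (K q').1 * k q'
      = (β (H q) (K q).1)⁻¹ * β (K q).1 (K q).1 * k q := h1
    rw [hK, hK] at h1'
    rw [hβ (H q) (H q) (hV _) (H q') h2]
    rw [mul_assoc, mul_assoc, inv_mul_eq_iff_eq_mul] at h1'
    rw [h1']; group

end HEproof

namespace HEproof

/-- `x` lies on the `n`-th circle, away from the base point. -/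
def onC (n : ℕ) (x : HE) : Prop := 0 < x.1.1 ∧ (n : ℝ) * (x.1.1 ^ 2 + x.1.2 ^ 2) = 2 * x.1.1

def slope (x : HE) : ℝ := x.1.2 / x.1.1

lemma HE_eqn (x : HE) : ∃ n : ℕ, 1 ≤ n ∧ (n : ℝ) * (x.1.1 ^ 2 + x.1.2 ^ 2) = 2 * x.1.1 := by
  obtain ⟨x, hx⟩ := x
  simp only [HE, mem_iUnion] at hx
  obtain ⟨n, hn, hx⟩ := hx
  refine ⟨n, hn, ?_⟩
  have hn0 : (n : ℝ) ≠ 0 := by positivity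
  simp only [circ, mem_ofPred_eq] at hx
  field_simp at hx
  have : (n:ℝ) * (n * (x.1 ^ 2 + x.2 ^ 2)) = n * (2 * x.1) := by nlinarith
  exact mul_left_cancel₀ hn0 this

lemma HE_onC (x : HE) (hx : x ≠ hep) : ∃ n, onC n x := by
  obtain ⟨n, hn, h⟩ := HE_eqn x
  have hn0 : (0 : ℝ) < n := by positivity
  refine ⟨n, ?_, h⟩
  by_contra hc
  push Not at hc
  have h0 : x.1.1 ^ 2 + x.1.2 ^ 2 = 0 := by
    have h1 : (n : ℝ) * (x.1.1 ^ 2 + x.1.2 ^ 2) ≤ 0 := by linarith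
    have h2 : 0 ≤ x.1.1 ^ 2 + x.1.2 ^ 2 := by positivity
    nlinarith
  apply hx
  apply Subtype.ext
  apply Prod.ext
  · change x.1.1 = 0; nlinarith [sq_nonneg x.1.1, sq_nonneg x.1.2]
  · change x.1.2 = 0; nlinarith [sq_nonneg x.1.1, sq_nonneg x.1.2]

lemma slope_mul {n : ℕ} {x : HE} (h : onC n x) : x.1.2 = slope x * x.1.1 := by
  rw [slope, div_mul_cancel₀ _ h.1.ne']

lemma onC_val {n : ℕ} {x : HE} (h : onC n x) : (n : ℝ) * (1 + slope x ^ 2) * x.1.1 = 2 := by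
  have h2 := h.2
  rw [slope_mul h] at h2
  have h1 := h.1
  have : x.1.1 * ((n : ℝ) * (1 + slope x ^ 2) * x.1.1) = x.1.1 * 2 := by nlinarith
  exact mul_left_cancel₀ h1.ne' this

lemma onC_unique {n m : ℕ} {x : HE} (h : onC n x) (h' : onC m x) : n = m := by
  have h1 := h.2
  have h2 := h'.2
  have : 0 < x.1.1 ^ 2 + x.1.2 ^ 2 := by have := h.1; positivity
  have : (n : ℝ) = m := mul_right_cancel₀ this.ne' (h1.trans h2.symm)
  exact_mod_cast this

lemma onC_ext {n : ℕ} {x x' : HE} (h : onC n x) (h' : onC n x') (hs : slope x = slope x') :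
    x = x' := by
  have h1 := onC_val h
  have h2 := onC_val h'
  rw [← hs] at h2
  have h3 : (n : ℝ) * (1 + slope x ^ 2) ≠ 0 := by
    intro h0; rw [h0] at h1; norm_num at h1
  have h4 : x.1.1 = x'.1.1 := mul_left_cancel₀ h3 (h1.trans h2.symm)
  apply Subtype.ext
  apply Prod.ext h4
  rw [slope_mul h, slope_mul h', hs, h4]

lemma onC_open (n : ℕ) : IsOpen {x : HE | onC n x} := by
  have : {x : HE | onC n x} = {x : HE | 0 < x.1.1} ∩
      {x : HE | |(n : ℝ) * (x.1.1 ^ 2 + x.1.2 ^ 2) - 2 * x.1.1| < x.1.1 ^ 2 + x.1.2 ^ 2} := by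
    ext x
    simp only [mem_ofPred_eq, mem_inter_iff, onC]
    refine and_congr_right fun hx => ?_
    have hp : 0 < x.1.1 ^ 2 + x.1.2 ^ 2 := by positivity
    constructor
    · intro h; rw [h]; simpa using hp
    · intro h
      obtain ⟨m, hm, h'⟩ := HE_eqn x
      rw [← h', ← sub_mul, abs_mul, abs_of_pos hp] at h
      have h2 : |(n : ℝ) - m| < 1 := by
        by_contra hc; push Not at hc; nlinarith
      have h3 : |(n : ℤ) - m| < 1 := by exact_mod_cast h2
      have h4 : (n : ℤ) = m := by rw [Int.abs_lt_one_iff] at h3; omega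
      have h5 : n = m := by exact_mod_cast h4
      rw [h5]; exact h'
  rw [this]
  apply IsOpen.inter
  · exact isOpen_lt (by fun_prop) (by fun_prop)
  · exact isOpen_lt (by fun_prop) (by fun_prop)

lemma slope_cont {n : ℕ} {x : HE} (h : onC n x) : ContinuousAt slope x := by
  unfold slope
  exact ContinuousAt.div (f := fun x : HE => x.1.2) (g := fun x : HE => x.1.1)
    (by fun_prop) (by fun_prop) h.1.ne'

lemma arc_closed (n : ℕ) (lo hi : ℝ) :
    IsClosed {x : HE | onC n x ∧ lo ≤ slope x ∧ slope x ≤ hi} := by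
  set M := max |lo| |hi| with hM
  have : {x : HE | onC n x ∧ lo ≤ slope x ∧ slope x ≤ hi} =
      {x : HE | (n : ℝ) * (x.1.1 ^ 2 + x.1.2 ^ 2) = 2 * x.1.1} ∩
      ({x : HE | lo * x.1.1 ≤ x.1.2} ∩ ({x : HE | x.1.2 ≤ hi * x.1.1} ∩
      {x : HE | 2 ≤ (n : ℝ) * (1 + M ^ 2) * x.1.1})) := by
    ext x
    simp only [mem_ofPred_eq, mem_inter_iff]
    constructor
    · rintro ⟨h, h1, h2⟩
      have hx := h.1
      refine ⟨h.2, ?_, ?_, ?_⟩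
      · rw [slope_mul h]; nlinarith
      · rw [slope_mul h]; nlinarith
      · rw [← onC_val h]
        have h3 : |slope x| ≤ M := by
          rw [abs_le]
          have := neg_abs_le lo
          have := le_abs_self hi
          have := le_max_left |lo| |hi|
          have := le_max_right |lo| |hi|
          constructor <;> linarith
        have h4 : slope x ^ 2 ≤ M ^ 2 := by
          rw [← sq_abs]; gcongr
        gcongr
    · rintro ⟨h1, h2, h3, h4⟩
      have hx : 0 < x.1.1 := by
        by_contra hc
        push Not at hc
        have : 0 ≤ (n : ℝ) * (1 + M ^ 2) := by positivity
        nlinarith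
      refine ⟨⟨hx, h1⟩, ?_, ?_⟩
      · rw [slope, le_div_iff₀ hx]; exact h2
      · rw [slope, div_le_iff₀ hx]; exact h3
  rw [this]
  refine IsClosed.inter ?_ (IsClosed.inter ?_ (IsClosed.inter ?_ ?_))
  · exact isClosed_eq (by fun_prop) (by fun_prop)
  all_goals exact isClosed_le (by fun_prop) (by fun_prop)

/-- Cut points: circle number and slope. -/
abbrev Cut := ℕ × ℝ

def atc (x : HE) (y : Cut) : Prop := onC y.1 x ∧ slope x = y.2

lemma atc_unique {x : HE} {y y' : Cut} (h : atc x y) (h' : atc x y') : y = y' :=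
  Prod.ext (onC_unique h.1 h'.1) (h.2.symm.trans h'.2)

lemma atc_ext {x x' : HE} {y : Cut} (h : atc x y) (h' : atc x' y) : x = x' :=
  onC_ext h.1 h'.1 (h.2.trans h'.2.symm)

/-- crossing the cut `y` positively by a small step from `a` to `b`. -/
def cr (y : Cut) (a b : HE) : Prop :=
  onC y.1 a ∧ onC y.1 b ∧ slope a < y.2 ∧ y.2 ≤ slope b ∧ slope b - slope a < 1

lemma near_ball {n : ℕ} {x : HE} (h : onC n x) {ε : ℝ} (hε : 0 < ε) :
    {a : HE | onC n a ∧ |slope a - slope x| < ε} ∈ 𝓝 x := by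
  apply Filter.inter_mem ((onC_open n).mem_nhds h)
  have := (slope_cont h).eventually (Metric.ball_mem_nhds (slope x) hε)
  exact this

lemma loc_not {x : HE} {y : Cut} (h : ¬ atc x y) :
    ∃ V ∈ 𝓝 x, ∀ a ∈ V, ∀ b ∈ V, ¬ cr y a b := by
  by_cases hx : onC y.1 x
  · have hs : slope x ≠ y.2 := fun hs => h ⟨hx, hs⟩
    refine ⟨_, near_ball hx (abs_pos.2 (sub_ne_zero.2 hs)), ?_⟩
    rintro a ⟨-, ha⟩ b ⟨-, hb⟩ ⟨-, -, h1, h2, -⟩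
    rw [abs_lt] at ha hb
    rcases lt_or_gt_of_ne hs with hlt | hlt
    · rw [abs_of_neg (by linarith)] at ha hb; linarith
    · rw [abs_of_pos (by linarith)] at ha hb; linarith
  · refine ⟨_, ((arc_closed y.1 (y.2 - 1) (y.2 + 1)).isOpen_compl).mem_nhds
      (fun hc => hx hc.1), ?_⟩
    rintro a ha b hb ⟨h0, -, h1, h2, h3⟩
    exact ha ⟨h0, by linarith, by linarith⟩

lemma loc_at {x : HE} {y : Cut} (h : atc x y) :
    ∃ V ∈ 𝓝 x, ∀ a ∈ V, ∀ b ∈ V, (cr y a b ↔ slope a < y.2 ∧ y.2 ≤ slope b) := by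
  refine ⟨_, near_ball h.1 (show (0:ℝ) < 1 / 2 by norm_num), ?_⟩
  rintro a ⟨ha1, ha⟩ b ⟨hb1, hb⟩
  rw [abs_lt] at ha hb
  constructor
  · rintro ⟨-, -, h1, h2, -⟩; exact ⟨h1, h2⟩
  · rintro ⟨h1, h2⟩; exact ⟨ha1, hb1, h1, h2, by linarith⟩

open Classical in
/-- The local cocycle of the finite set of cuts `Y`. -/
def g (Y : Finset Cut) (a b : HE) : FreeGroup Cut :=
  if h : ∃ y ∈ Y, cr y a b then FreeGroup.of h.choose
  else if h : ∃ y ∈ Y, cr y b a then (FreeGroup.of h.choose)⁻¹ else 1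

open Classical in
def bet (y : Cut) (a : HE) : FreeGroup Cut := if y.2 ≤ slope a then FreeGroup.of y else 1

lemma g_one {Y : Finset Cut} {a b : HE} (h1 : ∀ y ∈ Y, ¬ cr y a b) (h2 : ∀ y ∈ Y, ¬ cr y b a) :
    g Y a b = 1 := by
  unfold g
  rw [dif_neg (by push Not; exact h1), dif_neg (by push Not; exact h2)]

lemma g_of {Y : Finset Cut} {a b : HE} {y : Cut} (hy : y ∈ Y)
    (h1 : ∀ y' ∈ Y, y' ≠ y → ¬ cr y' a b) (h2 : ∀ y' ∈ Y, y' ≠ y → ¬ cr y' b a)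
    (h3 : cr y a b ↔ slope a < y.2 ∧ y.2 ≤ slope b)
    (h4 : cr y b a ↔ slope b < y.2 ∧ y.2 ≤ slope a) :
    g Y a b = bet y b * (bet y a)⁻¹ := by
  unfold g bet
  by_cases hab : cr y a b
  · have hex : ∃ y ∈ Y, cr y a b := ⟨y, hy, hab⟩
    have : hex.choose = y := by
      by_contra hc; exact h1 _ hex.choose_spec.1 hc hex.choose_spec.2
    rw [dif_pos hex, this, if_pos (h3.1 hab).2, if_neg (not_le.2 (h3.1 hab).1)]; simp
  · have hex : ¬ ∃ y ∈ Y, cr y a b := by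
      rintro ⟨y', hy', hc⟩
      by_cases he : y' = y
      · exact hab (he ▸ hc)
      · exact h1 _ hy' he hc
    rw [dif_neg hex]
    by_cases hba : cr y b a
    · have hex : ∃ y ∈ Y, cr y b a := ⟨y, hy, hba⟩
      have : hex.choose = y := by
        by_contra hc; exact h2 _ hex.choose_spec.1 hc hex.choose_spec.2
      rw [dif_pos hex, this, if_pos (h4.1 hba).2, if_neg (not_le.2 (h4.1 hba).1)]; simp
    · have hex : ¬ ∃ y ∈ Y, cr y b a := by
        rintro ⟨y', hy', hc⟩
        by_cases he : y' = y
        · exact hba (he ▸ hc)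
        · exact h2 _ hy' he hc
      rw [dif_neg hex]
      rw [h3] at hab
      rw [h4] at hba
      by_cases ha : y.2 ≤ slope a <;> by_cases hb : y.2 ≤ slope b
      · simp [ha, hb]
      · exact absurd ⟨not_le.1 hb, ha⟩ hba
      · exact absurd ⟨not_le.1 ha, hb⟩ hab
      · simp [ha, hb]

lemma g_loc (Y : Finset Cut) (x : HE) : ∃ V ∈ 𝓝 x,
    ((∀ y ∈ Y, ¬ atc x y) ∧ ∀ a ∈ V, ∀ b ∈ V, ∀ Y' ⊆ Y, g Y' a b = 1) ∨
    ∃ y ∈ Y, atc x y ∧ ∀ a ∈ V, ∀ b ∈ V, ∀ Y' ⊆ Y,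
      (y ∈ Y' → g Y' a b = bet y b * (bet y a)⁻¹) ∧ (y ∉ Y' → g Y' a b = 1) := by
  have hex : ∀ y : Cut, ∃ V ∈ 𝓝 x, (¬ atc x y → ∀ a ∈ V, ∀ b ∈ V, ¬ cr y a b) ∧
      (atc x y → ∀ a ∈ V, ∀ b ∈ V, (cr y a b ↔ slope a < y.2 ∧ y.2 ≤ slope b)) := by
    intro y
    by_cases h : atc x y
    · obtain ⟨V, hV, h'⟩ := loc_at h
      exact ⟨V, hV, fun h'' => absurd h h'', fun _ => h'⟩
    · obtain ⟨V, hV, h'⟩ := loc_not h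
      exact ⟨V, hV, fun _ => h', fun h'' => absurd h'' h⟩
  choose V hV h1 h2 using hex
  refine ⟨⋂ y ∈ Y, V y, (Filter.biInter_finset_mem Y).2 fun y _ => hV y, ?_⟩
  have hm : ∀ {a}, a ∈ ⋂ y ∈ Y, V y → ∀ y ∈ Y, a ∈ V y := fun ha y hy => by
    simp only [mem_iInter] at ha; exact ha y hy
  by_cases h : ∃ y ∈ Y, atc x y
  · right
    obtain ⟨y, hy, hat⟩ := h
    refine ⟨y, hy, hat, ?_⟩
    have hne : ∀ y' ∈ Y, y' ≠ y → ∀ a ∈ ⋂ y ∈ Y, V y, ∀ b ∈ ⋂ y ∈ Y, V y, ¬ cr y' a b :=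
      fun y' hy' hn a ha b hb =>
        h1 y' (fun hc => hn (atc_unique hc hat)) a (hm ha y' hy') b (hm hb y' hy')
    intro a ha b hb Y' hY'
    constructor
    · intro hyY'
      exact g_of hyY' (fun y' h' hn => hne y' (hY' h') hn a ha b hb)
        (fun y' h' hn => hne y' (hY' h') hn b hb a ha)
        (h2 y hat a (hm ha y hy) b (hm hb y hy)) (h2 y hat b (hm hb y hy) a (hm ha y hy))
    · intro hyY'
      exact g_one (fun y' h' => hne y' (hY' h') (fun e => hyY' (e ▸ h')) a ha b hb)
        (fun y' h' => hne y' (hY' h') (fun e => hyY' (e ▸ h')) b hb a ha)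
  · left
    push Not at h
    refine ⟨h, ?_⟩
    intro a ha b hb Y' hY'
    exact g_one (fun y' h' => h1 y' (h y' (hY' h')) a (hm ha y' (hY' h')) b (hm hb y' (hY' h')))
      (fun y' h' => h1 y' (h y' (hY' h')) b (hm hb y' (hY' h')) a (hm ha y' (hY' h')))

open Classical in
/-- Kill all letters outside `Y`. -/
def kill (Y : Finset Cut) : FreeGroup Cut →* FreeGroup Cut :=
  FreeGroup.lift (fun y => if y ∈ Y then FreeGroup.of y else 1)

lemma kill_bet_mem {Y : Finset Cut} {y : Cut} (h : y ∈ Y) (a : HE) :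
    kill Y (bet y a) = bet y a := by
  unfold bet kill; split_ifs <;> simp [h]

lemma kill_bet_not {Y : Finset Cut} {y : Cut} (h : y ∉ Y) (a : HE) :
    kill Y (bet y a) = 1 := by
  unfold bet kill; split_ifs <;> simp [h]

lemma g_kill {Y Y' : Finset Cut} (hYY : Y ⊆ Y') (x : HE) :
    ∃ V ∈ 𝓝 x, ∀ a ∈ V, ∀ b ∈ V, kill Y (g Y' a b) = g Y a b := by
  obtain ⟨V, hV, h⟩ := g_loc Y' x
  refine ⟨V, hV, fun a ha b hb => ?_⟩
  rcases h with ⟨-, h⟩ | ⟨y, hy, -, h⟩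
  · rw [h a ha b hb Y' (Finset.Subset.refl _), h a ha b hb Y hYY, map_one]
  · rw [(h a ha b hb Y' (Finset.Subset.refl _)).1 hy]
    by_cases hyY : y ∈ Y
    · rw [(h a ha b hb Y hYY).1 hyY, map_mul, map_inv, kill_bet_mem hyY, kill_bet_mem hyY]
    · rw [(h a ha b hb Y hYY).2 hyY, map_mul, map_inv, kill_bet_not hyY, kill_bet_not hyY]; simp

open Classical in
/-- Exponent sum of `y1` minus exponent sum of `y2`. -/
def expo (y1 y2 : Cut) : FreeGroup Cut →* Multiplicative ℤ :=
  FreeGroup.lift (fun y => if y = y1 then Multiplicative.ofAdd 1 else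
    if y = y2 then Multiplicative.ofAdd (-1) else 1)

open Classical in
def indS (n : ℕ) (m1 m2 : ℝ) (x : HE) : Multiplicative ℤ :=
  if onC n x ∧ m1 ≤ slope x ∧ slope x < m2 then Multiplicative.ofAdd 1 else 1

lemma indS_const {n : ℕ} {m1 m2 : ℝ} {x : HE} (h1 : ¬ atc x (n, m1)) (h2 : ¬ atc x (n, m2)) :
    ∃ V ∈ 𝓝 x, ∀ a ∈ V, indS n m1 m2 a = indS n m1 m2 x := by
  by_cases hx : onC n x
  · have hs1 : slope x ≠ m1 := fun hs => h1 ⟨hx, hs⟩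
    have hs2 : slope x ≠ m2 := fun hs => h2 ⟨hx, hs⟩
    refine ⟨_, Filter.inter_mem (near_ball hx (abs_pos.2 (sub_ne_zero.2 hs1)))
      (near_ball hx (abs_pos.2 (sub_ne_zero.2 hs2))), ?_⟩
    rintro a ⟨⟨ha, ha1⟩, ⟨-, ha2⟩⟩
    have e1 : m1 ≤ slope a ↔ m1 ≤ slope x := by
      rw [abs_lt] at ha1
      rcases lt_or_gt_of_ne hs1 with hlt | hlt
      · rw [abs_of_neg (by linarith)] at ha1; constructor <;> intro <;> linarith
      · rw [abs_of_pos (by linarith)] at ha1; constructor <;> intro <;> linarith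
    have e2 : slope a < m2 ↔ slope x < m2 := by
      rw [abs_lt] at ha2
      rcases lt_or_gt_of_ne hs2 with hlt | hlt
      · rw [abs_of_neg (by linarith)] at ha2; constructor <;> intro <;> linarith
      · rw [abs_of_pos (by linarith)] at ha2; constructor <;> intro <;> linarith
    unfold indS
    simp only [ha, hx, e1, e2]
  · refine ⟨_, ((arc_closed n m1 m2).isOpen_compl).mem_nhds (fun hc => hx hc.1), ?_⟩
    intro a ha
    unfold indS
    rw [if_neg (fun hc => ha ⟨hc.1, hc.2.1, hc.2.2.le⟩), if_neg (fun hc => hx hc.1)]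

lemma g_expo {Y : Finset Cut} {n : ℕ} {m1 m2 : ℝ} (hm : m1 < m2) (hy1 : (n, m1) ∈ Y)
    (hy2 : (n, m2) ∈ Y) (x : HE) :
    ∃ V ∈ 𝓝 x, ∀ a ∈ V, ∀ b ∈ V, expo (n, m1) (n, m2) (g Y a b) =
      indS n m1 m2 b * (indS n m1 m2 a)⁻¹ := by
  obtain ⟨V, hV, h⟩ := g_loc Y x
  have hYY : Y ⊆ Y := Finset.Subset.refl _
  by_cases h1 : atc x (n, m1)
  · have hb : ∀ a, onC n a ∧ |slope a - slope x| < m2 - m1 →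
        indS n m1 m2 a = expo (n, m1) (n, m2) (bet (n, m1) a) := by
      rintro a ⟨ha, ha'⟩
      have h3 : slope x = m1 := h1.2
      rw [abs_lt] at ha'
      have h4 : slope a < m2 := by linarith
      unfold indS bet expo
      by_cases hc : m1 ≤ slope a <;> simp [ha, h4, hc]
    refine ⟨_, Filter.inter_mem hV (near_ball h1.1 (sub_pos.2 hm)), ?_⟩
    rintro a ⟨ha, ha'⟩ b ⟨hb1, hb'⟩
    rcases h with ⟨h, -⟩ | ⟨y, hy, hat, h⟩
    · exact absurd h1 (h _ hy1)
    · obtain rfl := atc_unique h1 hat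
      rw [(h a ha b hb1 Y hYY).1 hy, map_mul, map_inv, hb a ha', hb b hb']
  by_cases h2 : atc x (n, m2)
  · have hb : ∀ a, onC n a ∧ |slope a - slope x| < m2 - m1 →
        indS n m1 m2 a = Multiplicative.ofAdd 1 * expo (n, m1) (n, m2) (bet (n, m2) a) := by
      rintro a ⟨ha, ha'⟩
      have h3 : slope x = m2 := h2.2
      rw [abs_lt] at ha'
      have h4 : m1 ≤ slope a := by linarith
      unfold indS bet expo
      by_cases hc : m2 ≤ slope a
      · simp only [ha, h4, hc, not_lt.2 hc, hm.ne']; simp [hm.ne']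
      · simp only [ha, h4, hc, not_le.1 hc]; simp
    refine ⟨_, Filter.inter_mem hV (near_ball h2.1 (sub_pos.2 hm)), ?_⟩
    rintro a ⟨ha, ha'⟩ b ⟨hb1, hb'⟩
    rcases h with ⟨h, -⟩ | ⟨y, hy, hat, h⟩
    · exact absurd h2 (h _ hy2)
    · obtain rfl := atc_unique h2 hat
      rw [(h a ha b hb1 Y hYY).1 hy, map_mul, map_inv, hb a ha', hb b hb']
      rw [mul_inv, mul_mul_mul_comm, mul_inv_cancel, one_mul]
  · obtain ⟨V', hV', h'⟩ := indS_const h1 h2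
    refine ⟨_, Filter.inter_mem hV hV', ?_⟩
    rintro a ⟨ha, ha'⟩ b ⟨hb1, hb'⟩
    rw [h' a ha', h' b hb', mul_inv_cancel]
    rcases h with ⟨-, h⟩ | ⟨y, hy, hat, h⟩
    · rw [h a ha b hb1 Y hYY, map_one]
    · have e1 : y ≠ (n, m1) := by rintro rfl; exact h1 hat
      have e2 : y ≠ (n, m2) := by rintro rfl; exact h2 hat
      have hb : ∀ a, expo (n, m1) (n, m2) (bet y a) = 1 := by
        intro a
        unfold expo bet
        split_ifs <;> simp [e1, e2]
      rw [(h a ha b hb1 Y hYY).1 hy, map_mul, map_inv, hb, hb]; simp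

end HEproof
namespace HEproof

lemma g_cocyc (Y : Finset Cut) : IsCocyc (g Y) := by
  intro x
  obtain ⟨V, hV, h⟩ := g_loc Y x
  obtain ⟨U, hUV, hU, hx⟩ := mem_nhds_iff.1 hV
  refine ⟨U, hU, hx, ?_⟩
  rcases h with ⟨-, h⟩ | ⟨y, hy, -, h⟩
  · refine ⟨fun _ => 1, fun a ha b hb => ?_⟩
    rw [h a (hUV ha) b (hUV hb) Y (Finset.Subset.refl _)]; simp
  · exact ⟨bet y, fun a ha b hb =>
      (h a (hUV ha) b (hUV hb) Y (Finset.Subset.refl _)).1 hy⟩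

lemma g_self (Y : Finset Cut) (x : HE) : g Y x x = 1 := by
  obtain ⟨V, -, hx, β, h⟩ := g_cocyc Y x
  rw [h x hx x hx, mul_inv_cancel]

/-- Evaluation of loops. -/
def evH : C(I × LoopSp HE hep, HE) := ⟨fun q => q.2.1 q.1, by fun_prop⟩

lemma w_ex (Y : Finset Cut) : ∃ w : I × LoopSp HE hep → FreeGroup Cut,
    (∀ a, w (0, a) = 1) ∧ IsLift (g Y) evH w :=
  exists_lift (g Y) (g_cocyc Y) hep evH (fun a => a.2.1)

/-- The word read off by the loop `f` up to time `s`. -/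
def W (Y : Finset Cut) (f : LoopSp HE hep) (s : I) : FreeGroup Cut := (w_ex Y).choose (s, f)

lemma W_zero (Y : Finset Cut) (f : LoopSp HE hep) : W Y f 0 = 1 := (w_ex Y).choose_spec.1 f

lemma W_lift (Y : Finset Cut) (f : LoopSp HE hep) : IsLift (g Y) f.1 (W Y f) :=
  (w_ex Y).choose_spec.2.comp (φ := fun s : I => (s, f)) (by fun_prop)

lemma W_one_loc (Y : Finset Cut) : IsLocallyConstant (fun f : LoopSp HE hep => W Y f 1) := by
  rw [IsLocallyConstant.iff_eventually_eq]
  intro f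
  have := (w_ex Y).choose_spec.2.comp (φ := fun f : LoopSp HE hep => ((1 : I), f))
    (by fun_prop) f
  filter_upwards [this] with f' h
  have e : ∀ f : LoopSp HE hep, evH (1, f) = hep := fun f => f.2.2
  simp only [Function.comp_apply, e, g_self, one_mul] at h
  exact h

lemma lift_map {G : Type*} [Group G] (Y : Finset Cut) (f : LoopSp HE hep) (φ : FreeGroup Cut →* G)
    (g' : HE → HE → G)
    (h : ∀ x, ∃ V ∈ 𝓝 x, ∀ a ∈ V, ∀ b ∈ V, φ (g Y a b) = g' a b) :
    IsLift g' f.1 (fun s => φ (W Y f s)) := by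
  intro s
  obtain ⟨V, hV, h⟩ := h (f.1 s)
  filter_upwards [W_lift Y f s, f.1.continuous.continuousAt.eventually hV] with t h1 h2
  rw [h1, map_mul, h _ (mem_of_mem_nhds hV) _ h2]

lemma W_kill {Y Y' : Finset Cut} (hYY : Y ⊆ Y') (f : LoopSp HE hep) (s : I) :
    kill Y (W Y' f s) = W Y f s := by
  refine IsLift.unique' (lift_map Y' f (kill Y) (g Y) (g_kill hYY)) (W_lift Y f) (s := 0) ?_ s
  rw [W_zero, W_zero, map_one]

lemma W_expo {Y : Finset Cut} {n : ℕ} {m1 m2 : ℝ} (hm : m1 < m2) (hy1 : (n, m1) ∈ Y)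
    (hy2 : (n, m2) ∈ Y) (f : LoopSp HE hep) (s t : I) :
    expo (n, m1) (n, m2) (W Y f t * (W Y f s)⁻¹) =
      indS n m1 m2 (f.1 t) * (indS n m1 m2 (f.1 s))⁻¹ := by
  have h1 := lift_map Y f (expo (n, m1) (n, m2))
    (fun a b => indS n m1 m2 b * (indS n m1 m2 a)⁻¹) (g_expo hm hy1 hy2)
  have h2 : IsLift (fun a b => indS n m1 m2 b * (indS n m1 m2 a)⁻¹) f.1
      (fun s => indS n m1 m2 (f.1 s)) := fun s => Filter.Eventually.of_forall fun t => by simp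
  have h3 := h2.unique h1 s t
  rw [map_mul, map_inv]
  rw [inv_mul_eq_iff_eq_mul] at h3
  rw [h3, mul_inv, mul_inv, inv_inv]
  generalize indS n m1 m2 (f.1 s) = a
  generalize indS n m1 m2 (f.1 t) = b
  generalize (expo (n, m1) (n, m2)) (W Y f t) = c
  rw [mul_left_comm c, mul_comm b, mul_inv_cancel_left, mul_comm]

lemma W_loc (Y : Finset Cut) (f : LoopSp HE hep) (τ : I) :
    (∀ᶠ t in 𝓝 τ, W Y f t = W Y f τ) ∨ ∃ y ∈ Y, atc (f.1 τ) y ∧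
      ∀ᶠ t in 𝓝 τ, W Y f t = W Y f τ ∨ W Y f t = FreeGroup.mk [(y, false)] * W Y f τ := by
  obtain ⟨V, hV, h⟩ := g_loc Y (f.1 τ)
  rcases h with ⟨-, h⟩ | ⟨y, hy, hat, h⟩
  · left
    filter_upwards [W_lift Y f τ, f.1.continuous.continuousAt.eventually hV] with t h1 h2
    rw [h1, h _ (mem_of_mem_nhds hV) _ h2 Y (Finset.Subset.refl _), one_mul]
  · right
    refine ⟨y, hy, hat, ?_⟩
    filter_upwards [W_lift Y f τ, f.1.continuous.continuousAt.eventually hV] with t h1 h2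
    rw [h1, (h _ (mem_of_mem_nhds hV) _ h2 Y (Finset.Subset.refl _)).1 hy]
    have e : bet y (f.1 τ) = FreeGroup.of y := by unfold bet; rw [if_pos hat.2.ge]
    rw [e]
    unfold bet
    split_ifs
    · left; simp
    · right; rw [one_mul]; rfl

lemma crossing (Y : Finset Cut) (f : LoopSp HE hep) (h0 : FreeGroup Cut) (l : Cut × Bool)
    (L : List (Cut × Bool)) (s t : I) (hs : ¬ (l :: L) <:+ (W Y f s * h0⁻¹).toWord)
    (ht : (l :: L) <:+ (W Y f t * h0⁻¹).toWord) :
    ∃ τ ∈ uIcc s t, atc (f.1 τ) l.1 ∧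
      W Y f τ = (if l.2 then FreeGroup.mk (l :: L) else FreeGroup.mk L) * h0 := by
  by_contra hc
  push Not at hc
  set P : I → Prop := fun τ => (l :: L) <:+ (W Y f τ * h0⁻¹).toWord with hP
  have key : ∀ τ ∈ uIcc s t, ∀ᶠ t' in 𝓝 τ, P t' ↔ P τ := by
    intro τ hτ
    rcases W_loc Y f τ with h | ⟨y, hy, hat, h⟩
    · filter_upwards [h] with t' h'
      simp only [hP, h']
    · filter_upwards [h] with t' h'
      rcases h' with h' | h'
      · simp only [hP, h']
      · by_contra hne
        have hh' : W Y f t' * h0⁻¹ = FreeGroup.mk [(y, false)] * (W Y f τ * h0⁻¹) := by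
          rw [h', mul_assoc]
        have hh : W Y f τ * h0⁻¹ = FreeGroup.mk [(y, true)] * (W Y f t' * h0⁻¹) := by
          rw [hh', ← mul_assoc, FreeGroup.mul_mk]
          have : FreeGroup.mk ([(y, true)] ++ [(y, false)]) = 1 := by
            change FreeGroup.of y * (FreeGroup.of y)⁻¹ = 1
            simp
          rw [this, one_mul]
        by_cases hPτ : P τ
        · have hPt : ¬ P t' := fun h => hne ⟨fun _ => hPτ, fun _ => h⟩
          simp only [hP] at hPτ hPt
          rw [hh'] at hPt
          obtain ⟨e1, e2, -⟩ := crossing_edge l (y, false) L _ hPτ hPt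
          simp only [Prod.mk.injEq] at e2
          have e3 : l.2 = true := by simpa using e2.2.symm
          refine hc τ hτ (e2.1 ▸ hat) ?_
          rw [if_pos e3, ← e1]; simp
        · have hPt : P t' := by tauto
          simp only [hP] at hPτ hPt
          rw [hh] at hPτ
          obtain ⟨-, e2, e1⟩ := crossing_edge l (y, true) L _ hPt hPτ
          rw [← hh] at e1
          simp only [Prod.mk.injEq] at e2
          have e3 : ¬ l.2 = true := by simpa using e2.2.symm
          refine hc τ hτ (e2.1 ▸ hat) ?_
          rw [if_neg e3, ← e1]; simp
  have hpre : IsPreconnected (uIcc s t) := isPreconnected_uIcc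
  obtain ⟨z, -, hz1, hz2⟩ := hpre (interior {τ | P τ}) (interior {τ | ¬ P τ}) isOpen_interior
    isOpen_interior (by
      intro τ hτ
      by_cases h : P τ
      · left; rw [mem_interior_iff_mem_nhds]
        filter_upwards [key τ hτ] with t' ht'; exact ht'.2 h
      · right; rw [mem_interior_iff_mem_nhds]
        filter_upwards [key τ hτ] with t' ht'; exact fun h' => h (ht'.1 h'))
    ⟨t, right_mem_uIcc, by
      rw [mem_interior_iff_mem_nhds]
      filter_upwards [key t right_mem_uIcc] with t' ht'; exact ht'.2 ht⟩
    ⟨s, left_mem_uIcc, by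
      rw [mem_interior_iff_mem_nhds]
      filter_upwards [key s left_mem_uIcc] with t' ht'; exact fun h' => hs (ht'.1 h')⟩
  have a1 : z ∈ {τ | P τ} := interior_subset hz1
  have a2 : z ∈ {τ | ¬ P τ} := interior_subset hz2
  exact a2 a1

/-- Points of the interval with same image in the tree-like quotient. -/
def Rel (f : LoopSp HE hep) (s t : I) : Prop := f.1 s = f.1 t ∧ ∀ Y, W Y f s = W Y f t

lemma Rel_equiv (f : LoopSp HE hep) : Equivalence (Rel f) :=
  ⟨fun _ => ⟨rfl, fun _ => rfl⟩, fun h => ⟨h.1.symm, fun Y => (h.2 Y).symm⟩,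
    fun h h' => ⟨h.1.trans h'.1, fun Y => (h.2 Y).trans (h'.2 Y)⟩⟩

lemma RelY_closed (f : LoopSp HE hep) (Y : Finset Cut) :
    IsClosed {q : I × I | f.1 q.1 = f.1 q.2 ∧ W Y f q.1 = W Y f q.2} := by
  rw [← isOpen_compl_iff, isOpen_iff_mem_nhds]
  rintro ⟨s, t⟩ hst
  simp only [mem_compl_iff, mem_ofPred_eq, not_and] at hst
  by_cases h : f.1 s = f.1 t
  · have hW := hst h
    have h1 := (continuous_fst.tendsto (s, t)).eventually (W_lift Y f s)
    have h2 := (continuous_snd.tendsto (s, t)).eventually (W_lift Y f t)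
    filter_upwards [h1, h2] with q e1 e2
    rintro ⟨e3, e4⟩
    rw [e1, e2, e3, h] at e4
    exact hW (mul_left_cancel e4)
  · have hcl : IsClosed {q : I × I | f.1 q.1 = f.1 q.2} :=
      isClosed_eq (by fun_prop) (by fun_prop)
    filter_upwards [hcl.isOpen_compl.mem_nhds (show (s, t) ∈ _ from h)] with q hq
    exact fun hc => hq hc.1

lemma Rel_closed (f : LoopSp HE hep) : IsClosed {q : I × I | Rel f q.1 q.2} := by
  have : {q : I × I | Rel f q.1 q.2} =
      ⋂ Y, {q : I × I | f.1 q.1 = f.1 q.2 ∧ W Y f q.1 = W Y f q.2} := by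
    ext q
    simp only [mem_iInter, mem_ofPred_eq, Rel]
    exact ⟨fun h Y => ⟨h.1, h.2 Y⟩, fun h => ⟨(h ∅).1, fun Y => (h Y).2⟩⟩
  rw [this]
  exact isClosed_iInter (RelY_closed f)

lemma letters_sub {α G : Type*} [Group G] (φ : FreeGroup α →* G) (S : Subgroup G)
    (L : List (α × Bool)) (h : ∀ l ∈ L, φ (FreeGroup.of l.1) ∈ S) : φ (FreeGroup.mk L) ∈ S := by
  induction L with
  | nil => change φ 1 ∈ S; rw [map_one]; exact S.one_mem
  | cons l L ih =>
    have e : FreeGroup.mk (l :: L) = FreeGroup.mk [l] * FreeGroup.mk L := by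
      rw [FreeGroup.mul_mk]; rfl
    rw [e, map_mul]
    refine S.mul_mem ?_ (ih fun l' hl' => h l' (List.mem_cons_of_mem _ hl'))
    have hl := h l List.mem_cons_self
    obtain ⟨a, b⟩ := l
    cases b
    · change φ (FreeGroup.of a)⁻¹ ∈ S
      rw [map_inv]; exact S.inv_mem hl
    · exact hl

lemma letters_sub' {α G : Type*} [DecidableEq α] [Group G] (φ : FreeGroup α →* G) (S : Subgroup G)
    (x : FreeGroup α) (h : ∀ l ∈ x.toWord, φ (FreeGroup.of l.1) ∈ S) : φ x ∈ S := by
  have := letters_sub φ S x.toWord h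
  rwa [FreeGroup.mk_toWord] at this

lemma sep_ind (f : LoopSp HE hep) (P Q : I) {n : ℕ} {m1 m2 : ℝ} (hm : m1 < m2)
    (hne : indS n m1 m2 (f.1 Q) ≠ indS n m1 m2 (f.1 P)) (Y' : Finset Cut)
    (hY : ({(n, m1), (n, m2)} : Finset Cut) ⊆ Y') :
    ∃ l ∈ (W Y' f Q * (W Y' f P)⁻¹).toWord, l.1 ∈ ({(n, m1), (n, m2)} : Finset Cut) := by
  by_contra hc
  push Not at hc
  have h1 : expo (n, m1) (n, m2) (W Y' f Q * (W Y' f P)⁻¹) ∈ (⊥ : Subgroup (Multiplicative ℤ)) := by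
    apply letters_sub'
    intro l hl
    have := hc l hl
    simp only [Finset.mem_insert, Finset.mem_singleton, not_or] at this
    simp [expo, this.1, this.2]
  rw [Subgroup.mem_bot, W_expo hm (hY (by simp)) (hY (by simp)), mul_inv_eq_one] at h1
  exact hne h1

lemma sep_pts (a b : HE) (hab : a ≠ b) (ha : a ≠ hep) : ∃ (n : ℕ) (m1 m2 : ℝ), m1 < m2 ∧
    ¬ atc a (n, m1) ∧ ¬ atc a (n, m2) ∧ ¬ atc b (n, m1) ∧ ¬ atc b (n, m2) ∧
    indS n m1 m2 a ≠ indS n m1 m2 b := by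
  obtain ⟨n, hn⟩ := HE_onC a ha
  obtain ⟨δ, hδ, hb⟩ : ∃ δ > 0, ¬ (onC n b ∧ |slope b - slope a| ≤ δ) := by
    by_cases hnb : onC n b
    · have : slope b - slope a ≠ 0 := fun h => hab (onC_ext hn hnb (by linarith))
      refine ⟨|slope b - slope a| / 2, by positivity, fun hc => ?_⟩
      have := abs_pos.2 this
      linarith [hc.2]
    · exact ⟨1, one_pos, fun hc => hnb hc.1⟩
  refine ⟨n, slope a - δ, slope a + δ, by linarith, ?_, ?_, ?_, ?_, ?_⟩
  · intro h; have := h.2; simp only at this; linarith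
  · intro h; have := h.2; simp only at this; linarith
  · intro h; have := h.2; simp only at this
    exact hb ⟨h.1, by rw [abs_le]; constructor <;> linarith⟩
  · intro h; have := h.2; simp only at this
    exact hb ⟨h.1, by rw [abs_le]; constructor <;> linarith⟩
  · unfold indS
    rw [if_pos ⟨hn, by linarith, by linarith⟩, if_neg]
    · decide
    · rintro ⟨h1, h2, h3⟩
      exact hb ⟨h1, by rw [abs_le]; constructor <;> linarith⟩

lemma sepletter (f : LoopSp HE hep) (P Q : I) (h : ¬ Rel f P Q) :
    ∃ Z Y2 : Finset Cut, (∀ y ∈ Z, ¬ atc (f.1 P) y ∧ ¬ atc (f.1 Q) y) ∧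
      ∀ Y', Y2 ⊆ Y' → ∃ l ∈ (W Y' f Q * (W Y' f P)⁻¹).toWord, l.1 ∈ Z := by
  by_cases hPQ : f.1 P = f.1 Q
  · have : ∃ Y, W Y f P ≠ W Y f Q := by
      by_contra hc; push Not at hc; exact h ⟨hPQ, hc⟩
    obtain ⟨Y, hY⟩ := this
    by_cases hat : ∃ y ∈ Y, atc (f.1 P) y
    · obtain ⟨⟨n, μ⟩, hy, hat⟩ := hat
      set Y2 : Finset Cut := insert (n, μ - 1) Y with hY2
      refine ⟨Y2.erase (n, μ), Y2, ?_, ?_⟩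
      · intro y' hy'
        have hn := Finset.ne_of_mem_erase hy'
        exact ⟨fun hc => hn (atc_unique hc hat), fun hc => hn (atc_unique (hPQ ▸ hc) hat)⟩
      · intro Y' hY'
        by_contra hc
        push Not at hc
        have h1 : kill Y2 (W Y' f Q * (W Y' f P)⁻¹) ∈
            Subgroup.zpowers (FreeGroup.of ((n, μ) : Cut)) := by
          apply letters_sub'
          intro l hl
          have hl' := hc l hl
          unfold kill
          rw [FreeGroup.lift_apply_of]
          split_ifs with hm
          · have : l.1 = (n, μ) := by
              by_contra hne; exact hl' (Finset.mem_erase.2 ⟨hne, hm⟩)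
            rw [this]; exact Subgroup.mem_zpowers _
          · exact Subgroup.one_mem _
        rw [map_mul, map_inv, W_kill hY', W_kill hY'] at h1
        obtain ⟨k, hk⟩ := Subgroup.mem_zpowers_iff.1 h1
        have h2 := W_expo (Y := Y2) (n := n) (m1 := μ - 1) (m2 := μ) (by linarith) (by simp [hY2])
          (by simp [hY2, hy]) f P Q
        rw [← hPQ, mul_inv_cancel, ← hk, map_zpow] at h2
        have h3 : expo (n, μ - 1) (n, μ) (FreeGroup.of (n, μ)) = Multiplicative.ofAdd (-1) := by
          have : μ ≠ μ - 1 := by linarith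
          simp [expo, this]
        rw [h3, ← ofAdd_zsmul, ofAdd_eq_one] at h2
        have hk0 : k = 0 := by simpa using h2
        rw [hk0, zpow_zero] at hk
        have h4 : W Y2 f Q = W Y2 f P := mul_inv_eq_one.1 hk.symm
        apply hY
        rw [← W_kill (Finset.subset_insert (n, μ - 1) Y), ← W_kill (Finset.subset_insert (n, μ - 1) Y)]
        rw [← hY2, h4]
    · push Not at hat
      refine ⟨Y, Y, fun y hy => ⟨hat y hy, hPQ ▸ hat y hy⟩, ?_⟩
      intro Y' hY'
      by_contra hc
      push Not at hc
      have h1 : kill Y (W Y' f Q * (W Y' f P)⁻¹) ∈ (⊥ : Subgroup (FreeGroup Cut)) := by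
        apply letters_sub'
        intro l hl
        simp [kill, hc l hl]
      rw [Subgroup.mem_bot, map_mul, map_inv, W_kill hY', W_kill hY', mul_inv_eq_one] at h1
      exact hY h1.symm
  · have : ∃ (n : ℕ) (m1 m2 : ℝ), m1 < m2 ∧
      ¬ atc (f.1 P) (n, m1) ∧ ¬ atc (f.1 P) (n, m2) ∧
      ¬ atc (f.1 Q) (n, m1) ∧ ¬ atc (f.1 Q) (n, m2) ∧
      indS n m1 m2 (f.1 Q) ≠ indS n m1 m2 (f.1 P) := by
      by_cases hP : f.1 P = hep
      · have hQ : f.1 Q ≠ hep := fun hQ => hPQ (hP.trans hQ.symm)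
        obtain ⟨n, m1, m2, h1, h2, h3, h4, h5, h6⟩ := sep_pts _ _ (Ne.symm hPQ) hQ
        exact ⟨n, m1, m2, h1, h4, h5, h2, h3, h6⟩
      · obtain ⟨n, m1, m2, h1, h2, h3, h4, h5, h6⟩ := sep_pts _ _ hPQ hP
        exact ⟨n, m1, m2, h1, h2, h3, h4, h5, h6.symm⟩
    obtain ⟨n, m1, m2, h1, h2, h3, h4, h5, h6⟩ := this
    refine ⟨{(n, m1), (n, m2)}, {(n, m1), (n, m2)}, ?_, fun Y' hY' => sep_ind f P Q h1 h6 Y' hY'⟩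
    intro y hy
    simp only [Finset.mem_insert, Finset.mem_singleton] at hy
    rcases hy with rfl | rfl
    · exact ⟨h2, h4⟩
    · exact ⟨h3, h5⟩

lemma atc_closed (y : Cut) : IsClosed {x : HE | atc x y} := by
  have : {x : HE | atc x y} = {x : HE | onC y.1 x ∧ y.2 ≤ slope x ∧ slope x ≤ y.2} := by
    ext x
    simp only [mem_ofPred_eq, atc]
    exact and_congr_right fun _ => ⟨fun h => ⟨h.ge, h.le⟩, fun h => le_antisymm h.2 h.1⟩
  rw [this]; exact arc_closed _ _ _

lemma hE_holds (f : LoopSp HE hep) (u ξ r τ' τ : I) (hr : Rel f r τ') (h1 : ∃ v ≤ u, Rel f v ξ)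
    (h2 : ∃ v ≤ u, Rel f v τ)
    (h3 : ∀ t, t ∈ uIcc ξ r ∪ uIcc τ τ' → (∃ v ≤ u, Rel f v t) → t = ξ ∨ t = τ) : Rel f ξ τ := by
  by_contra hc
  obtain ⟨Z, Y2, hZ, hlet⟩ := sepletter f ξ τ hc
  obtain ⟨v1, hv1, hR1⟩ := h1
  obtain ⟨v2, hv2, hR2⟩ := h2
  set K : Finset Cut → Set (I × I) := fun Y =>
    ((uIcc ξ r ∪ uIcc τ τ') ×ˢ Iic u) ∩ ((⋃ y ∈ Z, {q : I × I | atc (f.1 q.1) y}) ∩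
      {q : I × I | f.1 q.1 = f.1 q.2 ∧ W (Y ∪ Y2) f q.1 = W (Y ∪ Y2) f q.2}) with hK
  have hcl : ∀ Y, IsClosed (K Y) := by
    intro Y
    refine IsClosed.inter ((isClosed_Icc.union isClosed_Icc).prod isClosed_Iic)
      (IsClosed.inter ?_ (RelY_closed f _))
    exact Z.finite_toSet.isClosed_biUnion fun y _ =>
      (atc_closed y).preimage (by fun_prop : Continuous fun q : I × I => f.1 q.1)
  have hanti : ∀ Y Y', Y ⊆ Y' → K Y' ⊆ K Y := by
    intro Y Y' hYY q hq
    refine ⟨hq.1, hq.2.1, hq.2.2.1, ?_⟩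
    have hs : Y ∪ Y2 ⊆ Y' ∪ Y2 := Finset.union_subset_union_left hYY
    rw [← W_kill hs, ← W_kill hs, hq.2.2.2]
  have hne : ∀ Y, (K Y).Nonempty := by
    intro Y
    set Y' := Y ∪ Y2 with hY'
    obtain ⟨l, hl, hlZ⟩ := hlet Y' Finset.subset_union_right
    obtain ⟨L0, L1, hL⟩ := List.append_of_mem hl
    have hτ : (l :: L1) <:+ (W Y' f τ * (W Y' f ξ)⁻¹).toWord := ⟨L0, hL.symm⟩
    have hξ : ¬ (l :: L1) <:+ (W Y' f ξ * (W Y' f ξ)⁻¹).toWord := by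
      rw [mul_inv_cancel, FreeGroup.toWord_one]; simp
    obtain ⟨q2, hq2, hat2, hW2⟩ := crossing Y' f (W Y' f ξ) l L1 v1 v2
      (by rw [hR1.2 Y']; exact hξ) (by rw [hR2.2 Y']; exact hτ)
    have : ∃ q1 ∈ uIcc ξ r ∪ uIcc τ τ', atc (f.1 q1) l.1 ∧
        W Y' f q1 = (if l.2 then FreeGroup.mk (l :: L1) else FreeGroup.mk L1) * W Y' f ξ := by
      by_cases hrr : (l :: L1) <:+ (W Y' f r * (W Y' f ξ)⁻¹).toWord
      · obtain ⟨q, hq, h⟩ := crossing Y' f (W Y' f ξ) l L1 ξ r hξ hrr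
        exact ⟨q, Or.inl hq, h⟩
      · rw [hr.2 Y'] at hrr
        obtain ⟨q, hq, h⟩ := crossing Y' f (W Y' f ξ) l L1 τ' τ hrr hτ
        exact ⟨q, Or.inr (uIcc_comm τ' τ ▸ hq), h⟩
    obtain ⟨q1, hq1, hat1, hW1⟩ := this
    refine ⟨(q1, q2), ⟨hq1, hq2.2.trans (sup_le hv1 hv2)⟩, ?_, atc_ext hat1 hat2, hW1.trans hW2.symm⟩
    simp only [mem_iUnion]
    exact ⟨l.1, hlZ, hat1⟩
  obtain ⟨⟨t, v⟩, htv⟩ := IsCompact.nonempty_iInter_of_directed_nonempty_isCompact_isClosed K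
    (fun Y Y' => ⟨Y ∪ Y', hanti _ _ Finset.subset_union_left, hanti _ _ Finset.subset_union_right⟩)
    hne (fun Y => (hcl Y).isCompact) hcl
  rw [mem_iInter] at htv
  have hRel : Rel f v t := by
    refine ⟨(htv ∅).2.2.1.symm, fun Y => ?_⟩
    have hs : Y ⊆ Y ∪ Y2 := Finset.subset_union_left
    have := (htv Y).2.2.2
    simp only at this
    rw [← W_kill hs, ← W_kill hs, this]
  have hz := (htv ∅).2.1
  simp only [mem_iUnion] at hz
  obtain ⟨y, hy, hat⟩ := hz
  rcases h3 t (htv ∅).1.1 ⟨v, (htv ∅).1.2, hRel⟩ with rfl | rfl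
  · exact (hZ y hy).1 hat
  · exact (hZ y hy).2 hat

/-- The path underlying a loop. -/
def toP (f : LoopSp HE hep) : Path hep hep := ⟨f.1, f.2.1, f.2.2⟩

lemma null (k : LoopSp HE hep) (h : ∀ Y, W Y k 1 = 1) : (toP k).Homotopic (Path.refl hep) := by
  obtain ⟨H, h0, h1, h2, h3⟩ := contraction k.1 (Rel k) (Rel_equiv k) (Rel_closed k)
    (fun s t h => h.1) ⟨k.2.1.trans k.2.2.symm, fun Y => by rw [W_zero, h]⟩ (hE_holds k)
  apply Path.Homotopic.symm
  refine ⟨⟨⟨H.comp (ContinuousMap.mk Prod.swap), ?_, ?_⟩, ?_⟩⟩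
  · intro s
    change H (s, 0) = hep
    rw [h0, k.2.1]
  · intro s
    exact h1 s
  · intro t x hx
    rcases hx with rfl | hx
    · change H (0, t) = hep
      rw [h2, k.2.1]
    · obtain rfl := hx
      change H (1, t) = hep
      rw [h3, k.2.1]

lemma homot (f g' : LoopSp HE hep) (h : ∀ Y, W Y f 1 = W Y g' 1) :
    (toP f).Homotopic (toP g') := by
  set p : Path hep hep := (toP f).trans (toP g').symm with hp
  let k : LoopSp HE hep := ⟨p.toContinuousMap, p.source, p.target⟩
  have hk : toP k = p := rfl
  have hnull : p.Homotopic (Path.refl hep) := by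
    rw [← hk]
    apply null
    intro Y
    let φ : I → I := fun s => ⟨s / 2, by constructor <;> linarith [s.2.1, s.2.2]⟩
    let ψ : I → I := fun s => ⟨1 - s / 2, by constructor <;> linarith [s.2.1, s.2.2]⟩
    have hφ : Continuous φ := by fun_prop
    have hψ : Continuous ψ := by fun_prop
    have l1 := (W_lift Y k).comp hφ
    have l2 := (W_lift Y k).comp hψ
    have half : ∀ (q q' : Path hep hep) (s : I), (q.trans q') (φ s) = q s := by
      intro q q' s
      rw [Path.trans_apply, dif_pos (by change (s:ℝ) / 2 ≤ 1 / 2; linarith [s.2.2])]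
      congr 1
      apply Subtype.ext
      change 2 * ((s:ℝ) / 2) = s
      ring
    have e1 : k.1 ∘ φ = f.1 := by
      funext s
      exact half _ _ s
    have e2 : k.1 ∘ ψ = g'.1 := by
      funext s
      have h1 : p.symm (φ s) = (toP g') s := by
        rw [hp, Path.trans_symm, Path.symm_symm]
        exact half _ _ s
      exact h1
    rw [e1] at l1
    rw [e2] at l2
    have z0 : φ 0 = 0 := by apply Subtype.ext; change ((0:I):ℝ) / 2 = 0; simp
    have z1 : ψ 0 = 1 := by apply Subtype.ext; change 1 - ((0:I):ℝ) / 2 = 1; simp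
    have z2 : ψ 1 = φ 1 := by
      apply Subtype.ext; change 1 - ((1:I):ℝ) / 2 = ((1:I):ℝ) / 2; norm_num
    have u1 := l1.unique' (W_lift Y f) (s := 0)
      (by rw [Function.comp_apply, z0, W_zero, W_zero]) 1
    have u2 := (W_lift Y g').unique l2 0 1
    rw [Function.comp_apply] at u1
    rw [Function.comp_apply, Function.comp_apply, z1, z2, u1, h, W_zero] at u2
    simpa using u2
  have a1 : (toP f).Homotopic ((toP f).trans ((toP g').symm.trans (toP g'))) :=
    Path.Homotopic.trans ⟨(Path.Homotopy.transRefl _).symm⟩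
      (Path.Homotopic.hcomp (Path.Homotopic.refl _) ⟨Path.Homotopy.reflSymmTrans _⟩)
  have a2 : (p.trans (toP g')).Homotopic ((toP f).trans ((toP g').symm.trans (toP g'))) :=
    ⟨Path.Homotopy.transAssoc _ _ _⟩
  have a3 : (p.trans (toP g')).Homotopic (toP g') :=
    (Path.Homotopic.hcomp hnull (Path.Homotopic.refl _)).trans ⟨Path.Homotopy.reflTrans _⟩
  exact a1.trans (a2.symm.trans a3)

lemma joined_iff (f g' : LoopSp HE hep) : Joined f g' ↔ ∀ Y, W Y f 1 = W Y g' 1 := by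
  constructor
  · rintro ⟨γ⟩ Y
    have := ((W_one_loc Y).comp_continuous γ.continuous).apply_eq_of_preconnectedSpace 0 1
    simpa using this
  · intro h
    obtain ⟨F⟩ := homot f g' h
    refine ⟨⟨⟨fun t => ⟨F.toContinuousMap.curry t, ?_, ?_⟩, ?_⟩, ?_, ?_⟩⟩
    · exact F.source t
    · exact F.target t
    · exact Continuous.subtype_mk (F.toContinuousMap.curry.continuous) _
    · apply Subtype.ext; ext1 s; exact F.apply_zero s
    · apply Subtype.ext; ext1 s; exact F.apply_one s

lemma joined_closed (g' : LoopSp HE hep) : IsClosed {f : LoopSp HE hep | Joined f g'} := by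
  have : {f : LoopSp HE hep | Joined f g'} = ⋂ Y, {f | W Y f 1 = W Y g' 1} := by
    ext f; simp only [mem_iInter, mem_ofPred_eq, joined_iff]
  rw [this]
  exact isClosed_iInter fun Y => (W_one_loc Y).isClosed_fiber (W Y g' 1)

end HEproof

/-- The topological fundamental group `π₁(HE, p)` of the Hawaiian
earring, endowed with the quotient topology, is a T1 space. -/
theorem topPi1_HE_t1Space : T1Space (TopPi1 HE hep) := by
  refine ⟨fun x => ?_⟩
  induction x using Quotient.inductionOn with
  | h g' =>
  rw [← isQuotientMap_quotient_mk'.isClosed_preimage]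
  convert HEproof.joined_closed g' using 1
  ext f
  exact Quotient.eq (r := pathSetoid (LoopSp HE hep))

end
end
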